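/- arXiv:1202.3066 — 3 statements merged into one kernel-verified Lean document; each statement's English description precedes it below -/
import Mathlib

section
/- Assume r ≥ 2, let t be a positive integer with 2t < 3d, and let f be a nonzero homogeneous polynomial of degree d in x_0,…,x_r over K with sr(f) = t. If A, B ∈ S(f) are two non-identified decompositions, then there exists a subset Q of ℙ^r which is either a line, a union of two lines, or a smooth conic, such that (as sets of points of ℙ^r) A ∖ Q = B ∖ Q, and consequently #(A ∩ Q) = #(B ∩ Q). -/
open MvPolynomial

/-- The degree-`d` power of (a representative linear form of) a point of `ℙ^r`,
regarded as a homogeneous polynomial of degree `d` in `x_0, …, x_r`. -/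
noncomputable def powForm (K : Type) [Field K] (r d : ℕ)
    (p : Projectivization K (Fin (r + 1) → K)) : MvPolynomial (Fin (r + 1)) K :=
  (∑ i, MvPolynomial.C (p.rep i) * MvPolynomial.X i) ^ d

/-- The span of the `d`-th powers of the linear forms corresponding to a set of
points of `ℙ^r`. -/
noncomputable def decompSpan (K : Type) [Field K] (r d : ℕ)
    (S : Set (Projectivization K (Fin (r + 1) → K))) :
    Submodule K (MvPolynomial (Fin (r + 1)) K) :=
  Submodule.span K (powForm K r d '' S)

/-- The symmetric rank of `f`. -/
noncomputable def symRank (K : Type) [Field K] (r d : ℕ)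
    (f : MvPolynomial (Fin (r + 1)) K) : ℕ :=
  sInf {n | ∃ A : Finset (Projectivization K (Fin (r + 1) → K)),
    A.card = n ∧ f ∈ decompSpan K r d ↑A}

/-- `S(f)`: the set of decompositions of `f`, i.e. finite sets of points of `ℙ^r`
computing the symmetric rank of `f`. -/
def decompSet (K : Type) [Field K] (r d : ℕ) (f : MvPolynomial (Fin (r + 1)) K) :
    Set (Finset (Projectivization K (Fin (r + 1) → K))) :=
  {A | f ∈ decompSpan K r d ↑A ∧ A.card = symRank K r d f}

/-- The points of `ℙ^r` lying on the hypersurface `Z(q)`. -/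
def projZeros (K : Type) [Field K] (r : ℕ) (q : MvPolynomial (Fin (r + 1)) K) :
    Set (Projectivization K (Fin (r + 1) → K)) :=
  {p | MvPolynomial.eval p.rep q = 0}

/-- A line of `ℙ^r`. -/
def IsProjLine (K : Type) [Field K] (r : ℕ)
    (L : Set (Projectivization K (Fin (r + 1) → K))) : Prop :=
  ∃ W : Submodule K (Fin (r + 1) → K), Module.finrank K W = 2 ∧
    L = {p | p.rep ∈ W}

/-- A smooth conic of `ℙ^r`. -/
def IsSmoothConic (K : Type) [Field K] (r : ℕ)
    (C : Set (Projectivization K (Fin (r + 1) → K))) : Prop :=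
  ∃ u v w : Fin (r + 1) → K, LinearIndependent K ![u, v, w] ∧
    C = {p | ∃ s t : K, (s ≠ 0 ∨ t ≠ 0) ∧
      p.submodule = Submodule.span K {s ^ 2 • u + (s * t) • v + t ^ 2 • w}}


section PlaneConfigurations

open Module
open scoped Classical

variable {K V : Type*} [Field K] [AddCommGroup V] [Module K V]

/-- The space of homogeneous polynomial functions of degree `m` on `V`: the `m`-th power of the
space of linear functionals inside the algebra of functions. -/
noncomputable def formSpace (K V : Type*) [Field K] [AddCommGroup V] [Module K V] (m : ℕ) :
    Submodule K (V → K) :=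
  LinearMap.range (LinearMap.ltoFun K V K K) ^ m

/-- A finite set of vectors is separated if its elements represent distinct points of `ℙ(V)`. -/
def Separated (K : Type*) {V : Type*} [Field K] [AddCommGroup V] [Module K V]
    (Z : Finset V) : Prop :=
  ∀ u ∈ Z, u ≠ 0 ∧ ∀ w ∈ Z, w ∈ Submodule.span K {u} → w = u

/-- `Z` supports a nowhere vanishing linear relation between the evaluations of forms of
degree `m`; this is a strong form of the Cayley–Bacharach condition. -/
def CayleyBacharach (K : Type*) {V : Type*} [Field K] [AddCommGroup V] [Module K V]
    (m : ℕ) (Z : Finset V) : Prop :=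
  ∃ c : V → K, (∀ z ∈ Z, c z ≠ 0) ∧ ∀ g ∈ formSpace K V m, ∑ z ∈ Z, c z * g z = 0

/-- `Z` lies on a line of `ℙ(V)`. -/
def OnLine (K : Type*) {V : Type*} [Field K] [AddCommGroup V] [Module K V]
    (Z : Finset V) : Prop :=
  ∃ W : Submodule K V, finrank K W ≤ 2 ∧ ∀ z ∈ Z, z ∈ W

/-- `Z` lies on a union of two lines of `ℙ(V)`. -/
def OnTwoLines (K : Type*) {V : Type*} [Field K] [AddCommGroup V] [Module K V]
    (Z : Finset V) : Prop :=
  ∃ W₁ W₂ : Submodule K V, finrank K W₁ ≤ 2 ∧ finrank K W₂ ≤ 2 ∧ ∀ z ∈ Z, z ∈ W₁ ∨ z ∈ W₂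

/-- `Z` spans at most a plane of `ℙ(V)` and lies on a conic of its span. -/
def OnPlaneConic (K : Type*) {V : Type*} [Field K] [AddCommGroup V] [Module K V]
    (Z : Finset V) : Prop :=
  finrank K (Submodule.span K (Z : Set V)) ≤ 3 ∧ ∃ q ∈ formSpace K V 2,
    (∀ z ∈ Z, q z = 0) ∧ ∃ x ∈ Submodule.span K (Z : Set V), q x ≠ 0

lemma dual_mem_formSpace (φ : Dual K V) : (φ : V → K) ∈ formSpace K V 1 := by
  rw [formSpace, pow_one]
  exact ⟨φ, rfl⟩

lemma mul_mem_formSpace {m k : ℕ} {g h : V → K} (hg : g ∈ formSpace K V m)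
    (hh : h ∈ formSpace K V k) : g * h ∈ formSpace K V (m + k) := by
  rw [formSpace, pow_add]
  exact Submodule.mul_mem_mul hg hh

lemma one_mem_formSpace : (1 : V → K) ∈ formSpace K V 0 := by
  rw [formSpace, pow_zero]
  exact Submodule.one_le.mp le_rfl

lemma Separated.mono {Z Y : Finset V} (hZ : Separated K Z) (h : Y ⊆ Z) : Separated K Y :=
  fun u hu => ⟨(hZ u (h hu)).1, fun w hw => (hZ u (h hu)).2 w (h hw)⟩

lemma exists_form_of_notMem {W : Submodule K V} {p : V} (hp : p ∉ W) :
    ∃ φ ∈ formSpace K V 1, (∀ w ∈ W, φ w = 0) ∧ φ p ≠ 0 := by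
  obtain ⟨φ, h1, h2⟩ := Submodule.exists_le_ker_of_notMem hp
  exact ⟨φ, dual_mem_formSpace φ, fun w hw => h2 hw, h1⟩

lemma CayleyBacharach.residual {m k : ℕ} {Z : Finset V} (hZ : CayleyBacharach K (m + k) Z)
    {g : V → K} (hg : g ∈ formSpace K V k) :
    CayleyBacharach K m (Z.filter fun z => g z ≠ 0) := by
  obtain ⟨c, hc, hrel⟩ := hZ
  refine ⟨fun z => c z * g z, fun z hz => ?_, fun h hh => ?_⟩
  · rw [Finset.mem_filter] at hz
    exact mul_ne_zero (hc z hz.1) hz.2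
  · refine Eq.trans ?_ (hrel _ (mul_mem_formSpace hh hg))
    rw [Finset.sum_filter]
    refine Finset.sum_congr rfl fun z _ => ?_
    by_cases hz : g z = 0
    · simp [hz]
    · rw [if_pos hz, Pi.mul_apply]
      ring

lemma CayleyBacharach.add_two_le_card {m : ℕ} {Z : Finset V} (hZ : CayleyBacharach K m Z)
    (hs : Separated K Z) (hne : Z.Nonempty) : m + 2 ≤ Z.card := by
  induction m generalizing Z with
  | zero =>
    obtain ⟨c, hc, hrel⟩ := hZ
    have h1 := hrel 1 one_mem_formSpace
    by_contra! hcard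
    have hpos := hne.card_pos
    obtain ⟨z, rfl⟩ := Finset.card_eq_one.mp (show Z.card = 1 by omega)
    exact hc z (by simp) (by simpa using h1)
  | succ m ih =>
    obtain ⟨p, hp⟩ := hne
    have key : ∀ W : Submodule K V, p ∉ W →
        ∃ Y ⊆ Z, (∀ y ∈ Y, y ∉ W) ∧ p ∈ Y ∧ m + 2 ≤ Y.card := by
      intro W hW
      obtain ⟨φ, hφ, hφW, hφp⟩ := exists_form_of_notMem hW
      have hpY : p ∈ Z.filter fun z => φ z ≠ 0 := Finset.mem_filter.mpr ⟨hp, hφp⟩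
      refine ⟨_, Finset.filter_subset _ Z, fun y hy hyW => ?_, hpY,
        ih (hZ.residual hφ) (hs.mono (Finset.filter_subset _ _)) ⟨p, hpY⟩⟩
      exact (Finset.mem_filter.mp hy).2 (hφW y hyW)
    obtain ⟨Y, hYZ, -, -, hY⟩ := key ⊥ (by simpa using (hs p hp).1)
    have hcZ := Finset.card_le_card hYZ
    obtain ⟨q, hq, hqp⟩ := Finset.exists_mem_ne (by omega : 1 < Z.card) p
    obtain ⟨Y', hYZ', hYW', -, hY'⟩ := key (Submodule.span K {q})
      fun h => hqp ((hs q hq).2 p hp h).symm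
    have : Y' ⊂ Z := ⟨hYZ', fun h => hYW' q (h hq) (Submodule.mem_span_singleton_self q)⟩
    have := Finset.card_lt_card this
    omega

/-- Removing from a Cayley–Bacharach set the zeros of a form of degree `k` which does not vanish
at `p` leaves a nonempty Cayley–Bacharach set of degree smaller by `k`. -/
lemma CayleyBacharach.exists_residual {m k : ℕ} {Z T : Finset V}
    (hZ : CayleyBacharach K (m + k) Z) (hs : Separated K Z) {g : V → K}
    (hg : g ∈ formSpace K V k) {p : V} (hp : p ∈ Z) (hgp : g p ≠ 0) (hT : T ⊆ Z)
    (hgT : ∀ z ∈ T, g z = 0) :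
    ∃ Y ⊆ Z, CayleyBacharach K m Y ∧ Separated K Y ∧ (∀ y ∈ Y, g y ≠ 0) ∧ m + 2 ≤ Y.card ∧
      Y.card + T.card ≤ Z.card := by
  have hpY : p ∈ Z.filter fun z => g z ≠ 0 := Finset.mem_filter.mpr ⟨hp, hgp⟩
  have hs' : Separated K (Z.filter fun z => g z ≠ 0) := hs.mono (Finset.filter_subset _ _)
  refine ⟨_, Finset.filter_subset _ Z, hZ.residual hg, hs',
    fun y hy => (Finset.mem_filter.mp hy).2, (hZ.residual hg).add_two_le_card hs' ⟨p, hpY⟩, ?_⟩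
  rw [← Finset.card_union_of_disjoint]
  · exact Finset.card_le_card (Finset.union_subset (Finset.filter_subset _ _) hT)
  · rw [Finset.disjoint_left]
    exact fun z hz hzT => (Finset.mem_filter.mp hz).2 (hgT z hzT)

lemma CayleyBacharach.exists_residual_subspace {m : ℕ} {Z T : Finset V}
    (hZ : CayleyBacharach K (m + 1) Z) (hs : Separated K Z) {W : Submodule K V} {p : V}
    (hp : p ∈ Z) (hpW : p ∉ W) (hT : T ⊆ Z) (hTW : ∀ z ∈ T, z ∈ W) :
    ∃ Y ⊆ Z, CayleyBacharach K m Y ∧ Separated K Y ∧ (∀ y ∈ Y, y ∉ W) ∧ m + 2 ≤ Y.card ∧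
      Y.card + T.card ≤ Z.card := by
  obtain ⟨φ, hφ, hφW, hφp⟩ := exists_form_of_notMem hpW
  obtain ⟨Y, h1, h2, h3, h4, h5⟩ :=
    hZ.exists_residual hs hφ hp hφp hT fun z hz => hφW z (hTW z hz)
  exact ⟨Y, h1, h2, h3, fun y hy hyW => h4 y hy (hφW y hyW), h5⟩

lemma CayleyBacharach.card_add_le_of_notMem_of_notMem {m : ℕ} {Z T : Finset V}
    (hZ : CayleyBacharach K (m + 2) Z) (hs : Separated K Z) {W₁ W₂ : Submodule K V} {p : V}
    (hp : p ∈ Z) (hp₁ : p ∉ W₁) (hp₂ : p ∉ W₂) (hT : T ⊆ Z) (hTW : ∀ z ∈ T, z ∈ W₁ ∨ z ∈ W₂) :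
    m + 2 + T.card ≤ Z.card := by
  obtain ⟨φ, hφ, hφW, hφp⟩ := exists_form_of_notMem hp₁
  obtain ⟨ψ, hψ, hψW, hψp⟩ := exists_form_of_notMem hp₂
  obtain ⟨Y, -, -, -, -, h1, h2⟩ := hZ.exists_residual hs (mul_mem_formSpace hφ hψ) hp
    (mul_ne_zero hφp hψp) hT fun z hz => by
      rcases hTW z hz with h | h
      · simp [hφW z h]
      · simp [hψW z h]
  omega

lemma finrank_span_pair_le (a b : V) : finrank K (Submodule.span K {a, b}) ≤ 2 := by
  have := finrank_span_finset_le_card (R := K) ({a, b} : Finset V)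
  have h2 : ({a, b} : Finset V).card ≤ 2 := Finset.card_le_two
  rw [← Finset.coe_pair]
  exact this.trans h2

lemma finrank_span_triple_le (a b c : V) : finrank K (Submodule.span K {a, b, c}) ≤ 3 := by
  have := finrank_span_finset_le_card (R := K) ({a, b, c} : Finset V)
  have h2 : ({a, b, c} : Finset V).card ≤ 3 := Finset.card_le_three
  have h3 : (({a, b, c} : Finset V) : Set V) = {a, b, c} := by simp
  rw [← h3]
  exact this.trans h2

lemma onLine_of_card_le_two {Z : Finset V} (h : Z.card ≤ 2) : OnLine K Z :=
  ⟨Submodule.span K Z, (finrank_span_finset_le_card Z).trans h,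
    fun _ hz => Submodule.subset_span hz⟩

/-- A Cayley–Bacharach set of degree `m` with at most `2m + 1` points lies on a line. -/
lemma CayleyBacharach.onLine {m : ℕ} {Z : Finset V} (hZ : CayleyBacharach K m Z)
    (hs : Separated K Z) (hcard : Z.card ≤ 2 * m + 1) : OnLine K Z := by
  induction m generalizing Z with
  | zero => exact onLine_of_card_le_two (by omega)
  | succ m ih =>
    by_contra hline
    have key : ∀ W : Submodule K V, finrank K W ≤ 2 → ∀ T ⊆ Z, (∀ z ∈ T, z ∈ W) →
        ∃ Y ⊆ Z, CayleyBacharach K m Y ∧ Separated K Y ∧ (∀ y ∈ Y, y ∉ W) ∧ m + 2 ≤ Y.card ∧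
          Y.card + T.card ≤ Z.card := by
      intro W hW T hT hTW
      have : ∃ p ∈ Z, p ∉ W := by
        by_contra! h
        exact hline ⟨W, hW, h⟩
      obtain ⟨p, hp, hpW⟩ := this
      exact hZ.exists_residual_subspace hs hp hpW hT hTW
    have h2 : 2 < Z.card := by
      by_contra! h
      exact hline (onLine_of_card_le_two h)
    obtain ⟨T, hT, hTcard⟩ := Finset.exists_subset_card_eq h2.le
    obtain ⟨Y, hYZ, hY, hYs, -, hYc, hYT⟩ := key (Submodule.span K T)
      ((finrank_span_finset_le_card T).trans hTcard.le) T hT fun z hz => Submodule.subset_span hz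
    obtain ⟨W, hW, hYW⟩ := ih hY hYs (by omega)
    obtain ⟨Y', -, -, -, -, hYc', hYT'⟩ := key W hW Y hYZ hYW
    omega

lemma CayleyBacharach.le_card_of_not_onLine {m : ℕ} {Z : Finset V} (hZ : CayleyBacharach K m Z)
    (hs : Separated K Z) (h : ¬ OnLine K Z) : 2 * m + 2 ≤ Z.card := by
  by_contra! hc
  exact h (hZ.onLine hs (by omega))

lemma OnLine.onTwoLines {Z : Finset V} (h : OnLine K Z) : OnTwoLines K Z := by
  obtain ⟨W, hW, h⟩ := h
  exact ⟨W, W, hW, hW, fun z hz => Or.inl (h z hz)⟩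

lemma CayleyBacharach.onTwoLines_of_line {m : ℕ} {Z T : Finset V}
    (hZ : CayleyBacharach K (m + 2) Z) (hs : Separated K Z) (hcard : Z.card + 1 ≤ 3 * (m + 2))
    (hT : T ⊆ Z) (hTline : OnLine K T) (hTcard : m + 3 ≤ T.card) : OnTwoLines K Z := by
  obtain ⟨W, hW, hTW⟩ := hTline
  by_cases hp : ∃ p ∈ Z, p ∉ W
  · obtain ⟨p, hp, hpW⟩ := hp
    obtain ⟨Y, hYZ, hY, hYs, hYW, hYc, hYT⟩ :=
      CayleyBacharach.exists_residual_subspace (m := m + 1) hZ hs hp hpW hT hTW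
    obtain ⟨W', hW', hYW'⟩ := hY.onLine hYs (by omega)
    refine ⟨W, W', hW, hW', ?_⟩
    by_contra! h
    obtain ⟨e, he, heW, heW'⟩ := h
    have hdisj : Disjoint T Y := Finset.disjoint_left.mpr fun z hz hzY => hYW z hzY (hTW z hz)
    have := hZ.card_add_le_of_notMem_of_notMem hs he heW heW' (Finset.union_subset hT hYZ)
      fun z hz => (Finset.mem_union.mp hz).imp (hTW z) (hYW' z)
    rw [Finset.card_union_of_disjoint hdisj] at this
    omega
  · push Not at hp
    exact OnLine.onTwoLines ⟨W, hW, hp⟩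

/-- Induction step: if a proper subspace contains three points of `Z`, then `Z` lies on two lines
or on a plane conic as soon as this holds for smaller sets. -/
lemma CayleyBacharach.onTwoLines_or_onPlaneConic_of_subspace {d : ℕ} {Z T : Finset V}
    (ih : ∀ Y : Finset V, Separated K Y → CayleyBacharach K (d + 1) Y →
      Y.card + 1 ≤ 3 * (d + 1) → OnTwoLines K Y ∨ OnPlaneConic K Y)
    (hs : Separated K Z) (hZ : CayleyBacharach K (d + 2) Z) (hcard : Z.card + 1 ≤ 3 * (d + 2))
    {W : Submodule K V} {p : V} (hp : p ∈ Z) (hpW : p ∉ W) (hT : T ⊆ Z) (hTW : ∀ z ∈ T, z ∈ W)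
    (hTcard : 3 ≤ T.card) : OnTwoLines K Z ∨ OnPlaneConic K Z := by
  obtain ⟨Y, hYZ, hY, hYs, -, hYc, hYT⟩ :=
    CayleyBacharach.exists_residual_subspace (m := d + 1) hZ hs hp hpW hT hTW
  by_cases hline : OnLine K Y
  · exact Or.inl (hZ.onTwoLines_of_line hs hcard hYZ hline hYc)
  have hYc' := hY.le_card_of_not_onLine hYs hline
  rcases ih Y hYs hY (by omega) with ⟨W₁, W₂, hW₁, hW₂, hYW⟩ | ⟨hr, q, hq, hqY, x, hx, hqx⟩
  · refine Or.inl ⟨W₁, W₂, hW₁, hW₂, ?_⟩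
    by_contra! h
    obtain ⟨e, he, he₁, he₂⟩ := h
    have := hZ.card_add_le_of_notMem_of_notMem hs he he₁ he₂ hYZ hYW
    omega
  · have hspan : ∀ z ∈ Z, z ∈ Submodule.span K (Y : Set V) := by
      by_contra! h
      obtain ⟨e, he, heY⟩ := h
      obtain ⟨Y', -, -, -, -, h1, h2⟩ := CayleyBacharach.exists_residual_subspace (m := d + 1)
        hZ hs he heY hYZ fun z hz => Submodule.subset_span hz
      omega
    have hqZ : ∀ z ∈ Z, q z = 0 := by
      by_contra! h
      obtain ⟨e, he, heq⟩ := h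
      obtain ⟨Y', -, -, -, -, h1, h2⟩ := hZ.exists_residual hs hq he heq hYZ hqY
      omega
    have hle : Submodule.span K (Z : Set V) = Submodule.span K (Y : Set V) :=
      le_antisymm (Submodule.span_le.mpr hspan) (Submodule.span_mono (by exact_mod_cast hYZ))
    exact Or.inr ⟨hle ▸ hr, q, hq, hqZ, x, hle ▸ hx, hqx⟩

/-- A finite set of coplanar points without three points on a line or six points on a conic. -/
structure InGeneralPosition (K : Type*) {V : Type*} [Field K] [AddCommGroup V] [Module K V]
    (Z : Finset V) : Prop where
  card_le_two_of_onLine : ∀ T ⊆ Z, OnLine K T → T.card ≤ 2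
  mem_span_triple : ∀ a ∈ Z, ∀ b ∈ Z, ∀ c ∈ Z, a ≠ b → a ≠ c → b ≠ c →
    ∀ z ∈ Z, z ∈ Submodule.span K {a, b, c}
  conic_eq_zero : ∀ q ∈ formSpace K V 2, ∀ T ⊆ Z, 6 ≤ T.card → (∀ z ∈ T, q z = 0) →
    ∀ x ∈ Submodule.span K (Z : Set V), q x = 0

lemma InGeneralPosition.notMem_span_pair {Z : Finset V} (h : InGeneralPosition K Z) {a b c : V}
    (ha : a ∈ Z) (hb : b ∈ Z) (hc : c ∈ Z) (hab : a ≠ b) (hac : a ≠ c) (hbc : b ≠ c) :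
    c ∉ Submodule.span K {a, b} := by
  intro hmem
  have h2 := h.card_le_two_of_onLine {a, b, c} (by
    intro z hz
    simp only [Finset.mem_insert, Finset.mem_singleton] at hz
    rcases hz with rfl | rfl | rfl <;> assumption)
    ⟨Submodule.span K {a, b}, finrank_span_pair_le a b, fun z hz => by
      simp only [Finset.mem_insert, Finset.mem_singleton] at hz
      rcases hz with rfl | rfl | rfl
      · exact Submodule.subset_span (by simp)
      · exact Submodule.subset_span (by simp)
      · exact hmem⟩
  rw [Finset.card_eq_three.mpr ⟨a, b, c, hab, hac, hbc, rfl⟩] at h2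
  omega

lemma InGeneralPosition.exists_line {Z : Finset V} (h : InGeneralPosition K Z) {a b : V}
    (ha : a ∈ Z) (hb : b ∈ Z) (hab : a ≠ b) :
    ∃ l : Dual K V, l a = 0 ∧ l b = 0 ∧ ∀ e ∈ Z, a ≠ e → b ≠ e → l e ≠ 0 := by
  by_cases hex : ∃ c ∈ Z, a ≠ c ∧ b ≠ c
  · obtain ⟨c, hc, hac, hbc⟩ := hex
    obtain ⟨l, hlc, hl⟩ :=
      Submodule.exists_le_ker_of_notMem (h.notMem_span_pair ha hb hc hab hac hbc)
    have hla : l a = 0 := hl (Submodule.subset_span (by simp))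
    have hlb : l b = 0 := hl (Submodule.subset_span (by simp))
    refine ⟨l, hla, hlb, fun e he hae hbe hle => ?_⟩
    obtain ⟨x, y, z, rfl⟩ :=
      Submodule.mem_span_triple.mp (h.mem_span_triple a ha b hb c hc hab hac hbc e he)
    have hz : z = 0 := by simpa [hla, hlb, hlc] using hle
    refine h.notMem_span_pair ha hb he hab hae hbe ?_
    rw [hz, zero_smul, add_zero]
    exact Submodule.mem_span_pair.mpr ⟨x, y, rfl⟩
  · push Not at hex
    exact ⟨0, rfl, rfl, fun e he hae hbe => absurd (hex e he hae) hbe⟩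

/-- If no form of degree `i` separates the point `a` from the other points of `S`, then `S`
contains a Cayley–Bacharach set of degree `i` passing through `a`. -/
lemma exists_cayleyBacharach_subset {i : ℕ} {S : Finset V} {a : V} (ha : a ∈ S)
    (h : ∀ g ∈ formSpace K V i, (∀ z ∈ S, z ≠ a → g z = 0) → g a = 0) :
    ∃ Y ⊆ S, a ∈ Y ∧ CayleyBacharach K i Y := by
  let ev : V → Dual K (formSpace K V i) :=
    fun z => (LinearMap.proj z).comp (formSpace K V i).subtype
  have hmem : ev a ∈ Submodule.span K (Set.range fun z : S.erase a => ev z) := by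
    refine mem_span_of_iInf_ker_le_ker fun g hg => ?_
    rw [Submodule.mem_iInf] at hg
    exact h g g.2 fun z hz hza => hg ⟨z, Finset.mem_erase.mpr ⟨hza, hz⟩⟩
  obtain ⟨b, hb⟩ := (Submodule.mem_span_range_iff_exists_fun K).mp hmem
  let c : V → K := fun z => if hz : z ∈ S.erase a then b ⟨z, hz⟩ else -1
  have hca : c a = -1 := by simp [c]
  refine ⟨S.filter fun z => c z ≠ 0, Finset.filter_subset _ _,
    Finset.mem_filter.mpr ⟨ha, by simp [hca]⟩, c, fun z hz => (Finset.mem_filter.mp hz).2,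
    fun g hg => ?_⟩
  have h1 : ∑ z ∈ S.erase a, c z * g z = g a := by
    have h2 := LinearMap.congr_fun hb ⟨g, hg⟩
    rw [LinearMap.sum_apply] at h2
    rw [← Finset.sum_coe_sort]
    refine Eq.trans (Finset.sum_congr rfl fun z _ => ?_) h2
    simp only [c, dif_pos z.2]
    rfl
  rw [Finset.sum_filter_of_ne fun z _ hz => left_ne_zero_of_mul hz,
    ← Finset.add_sum_erase S _ ha, h1, hca]
  ring

lemma InGeneralPosition.exists_form {d i : ℕ} {Z S : Finset V}
    (ih : ∀ i < d, ∀ Y : Finset V, Separated K Y → CayleyBacharach K i Y →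
      Y.card + 1 ≤ 3 * i → OnTwoLines K Y ∨ OnPlaneConic K Y)
    (h : InGeneralPosition K Z) (hs : Separated K Z) (hi : i < d)
    (hS : S ⊆ Z) (hcard : S.card + 1 ≤ 3 * i) {a : V} (ha : a ∈ S) :
    ∃ g ∈ formSpace K V i, (∀ z ∈ S, z ≠ a → g z = 0) ∧ g a ≠ 0 := by
  by_contra! hcon
  obtain ⟨Y, hYS, haY, hY⟩ := exists_cayleyBacharach_subset ha hcon
  have hYZ := hYS.trans hS
  have hYs := hs.mono hYZ
  have hle := Finset.card_le_card hYS
  have hY2 := hY.add_two_le_card hYs ⟨a, haY⟩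
  have hline : ¬ OnLine K Y := fun hline => by
    have := h.card_le_two_of_onLine Y hYZ hline
    omega
  have hYc := hY.le_card_of_not_onLine hYs hline
  rcases ih i hi Y hYs hY (by omega) with ⟨W₁, W₂, hW₁, hW₂, hYW⟩ | ⟨-, q, hq, hqY, x, hx, hqx⟩
  · have h1 := h.card_le_two_of_onLine (Y.filter (· ∈ W₁)) ((Finset.filter_subset _ _).trans hYZ)
      ⟨W₁, hW₁, fun z hz => (Finset.mem_filter.mp hz).2⟩
    have h2 := h.card_le_two_of_onLine (Y.filter (· ∈ W₂)) ((Finset.filter_subset _ _).trans hYZ)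
      ⟨W₂, hW₂, fun z hz => (Finset.mem_filter.mp hz).2⟩
    have h3 : Y.card ≤ (Y.filter (· ∈ W₁)).card + (Y.filter (· ∈ W₂)).card := by
      refine (Finset.card_le_card fun z hz => ?_).trans (Finset.card_union_le _ _)
      simpa [hz] using hYW z hz
    omega
  · exact hqx (h.conic_eq_zero q hq Y hYZ (by omega) hqY x
      (Submodule.span_mono (by exact_mod_cast hYZ) hx))

/-- Two curves of degree `j` through `3j - 1` points each, with all but one point in common,
cannot exist if every curve of degree `j + 1` through `3j + 2` points of `Z` contains `Z`. -/
lemma InGeneralPosition.false_of_forms {j : ℕ} {Z S : Finset V}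
    (h : InGeneralPosition K Z)
    (hj : ∀ g ∈ formSpace K V (j + 1), ∀ T ⊆ Z, 3 * j + 2 ≤ T.card → (∀ z ∈ T, g z = 0) →
      ∀ z ∈ Z, g z = 0)
    {a b : V} (haZ : a ∈ Z) (hbZ : b ∈ Z) (hab : a ≠ b) (haS : a ∉ S) (hbS : b ∉ S)
    (hS : S ⊆ Z) (hScard : S.card + 2 = 3 * j) (hcard : S.card + 6 ≤ Z.card)
    {G G' : V → K} (hG : G ∈ formSpace K V j) (hG' : G' ∈ formSpace K V j)
    (hGS : ∀ z ∈ S, G z = 0) (hGS' : ∀ z ∈ S, G' z = 0) (hGa : G a = 0) (hGb : G' b = 0)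
    (hGne : ∀ z ∈ Z, z ∉ S → z ≠ a → G z ≠ 0) (hGne' : ∀ z ∈ Z, z ∉ S → z ≠ b → G' z ≠ 0) :
    False := by
  have key : ∀ x ∈ Z, x ∉ S → a ≠ x → b ≠ x → ∃ l l' : Dual K V, ∃ r : K, r ≠ 0 ∧
      l x = 0 ∧ l b = 0 ∧ l' x = 0 ∧ l' a = 0 ∧ (∀ e ∈ Z, x ≠ e → b ≠ e → l e ≠ 0) ∧
      (∀ e ∈ Z, x ≠ e → a ≠ e → l' e ≠ 0) ∧ ∀ z ∈ Z, l z * G z = r * (l' z * G' z) := by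
    intro x hx hxS hax hbx
    obtain ⟨l, hlx, hlb, hl⟩ := h.exists_line hx hbZ hbx.symm
    obtain ⟨l', hlx', hla', hl'⟩ := h.exists_line hx haZ hax.symm
    let T := insert x (insert a (insert b S))
    have hTcard : T.card = S.card + 3 := by
      rw [Finset.card_insert_of_notMem (by simp [hax.symm, hbx.symm, hxS]),
        Finset.card_insert_of_notMem (by simp [hab, haS]), Finset.card_insert_of_notMem hbS]
    have hTZ : T ⊆ Z := by
      simp only [T, Finset.insert_subset_iff]
      exact ⟨hx, haZ, hbZ, hS⟩
    obtain ⟨e, he, heT⟩ := Finset.exists_mem_notMem_of_card_lt_card (by omega : T.card < Z.card)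
    simp only [T, Finset.mem_insert, not_or] at heT
    obtain ⟨hex, hea, heb, heS⟩ := heT
    have h1 : l e * G e ≠ 0 :=
      mul_ne_zero (hl e he (Ne.symm hex) (Ne.symm heb)) (hGne e he heS hea)
    have h2 : l' e * G' e ≠ 0 :=
      mul_ne_zero (hl' e he (Ne.symm hex) (Ne.symm hea)) (hGne' e he heS heb)
    refine ⟨l, l', l e * G e / (l' e * G' e), div_ne_zero h1 h2, hlx, hlb, hlx', hla', hl, hl',
      ?_⟩
    have hform : G * l - (l e * G e / (l' e * G' e)) • (G' * l') ∈ formSpace K V (j + 1) :=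
      Submodule.sub_mem _ (mul_mem_formSpace hG (dual_mem_formSpace l))
        (Submodule.smul_mem _ _ (mul_mem_formSpace hG' (dual_mem_formSpace l')))
    have hzero := hj _ hform (insert e T) (Finset.insert_subset he hTZ) (by
      rw [Finset.card_insert_of_notMem (by simp [T, hex, hea, heb, heS])]
      omega) (by
      intro z hz
      simp only [T, Finset.mem_insert] at hz
      simp only [Pi.sub_apply, Pi.mul_apply, Pi.smul_apply, smul_eq_mul]
      rcases hz with rfl | rfl | rfl | rfl | hz
      · rw [mul_comm (G' z) (l' z), div_mul_cancel₀ _ h2]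
        ring
      · rw [hlx, hlx']
        ring
      · rw [hGa, hla']
        ring
      · rw [hGb, hlb]
        ring
      · rw [hGS z hz, hGS' z hz]
        ring)
    intro z hz
    have := hzero z hz
    simp only [Pi.sub_apply, Pi.mul_apply, Pi.smul_apply, smul_eq_mul] at this
    linear_combination this
  obtain ⟨T, hTS, hTcard⟩ : ∃ T ⊆ Z \ (insert a (insert b S)), T.card = 2 := by
    refine Finset.exists_subset_card_eq ?_
    have h1 := Finset.le_card_sdiff (insert a (insert b S)) Z
    have h2 := Finset.card_insert_le a (insert b S)
    have h3 := Finset.card_insert_le b S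
    omega
  obtain ⟨x, y, hxy, rfl⟩ := Finset.card_eq_two.mp hTcard
  have hx := hTS (Finset.mem_insert_self x {y})
  have hy := hTS (Finset.mem_insert_of_mem (Finset.mem_singleton_self y))
  simp only [Finset.mem_sdiff, Finset.mem_insert, not_or] at hx hy
  obtain ⟨hxZ, hxa, hxb, hxS⟩ := hx
  obtain ⟨hyZ, hya, hyb, hyS⟩ := hy
  obtain ⟨l, l', r, hr, hlx, hlb, hlx', hla', hl, -, hlG⟩ :=
    key x hxZ hxS (Ne.symm hxa) (Ne.symm hxb)
  obtain ⟨m, m', s, hs, -, hmb, -, hma', -, hm', hmG⟩ :=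
    key y hyZ hyS (Ne.symm hya) (Ne.symm hyb)
  have hq : s • ((l : V → K) * m') - r • ((l' : V → K) * m) ∈ formSpace K V 2 :=
    Submodule.sub_mem _
      (Submodule.smul_mem _ _ (mul_mem_formSpace (dual_mem_formSpace l) (dual_mem_formSpace m')))
      (Submodule.smul_mem _ _ (mul_mem_formSpace (dual_mem_formSpace l') (dual_mem_formSpace m)))
  have hzero := h.conic_eq_zero _ hq (Z \ S) Finset.sdiff_subset
    (by have := Finset.le_card_sdiff S Z; omega) (by
      intro z hz
      rw [Finset.mem_sdiff] at hz
      simp only [Pi.sub_apply, Pi.mul_apply, Pi.smul_apply, smul_eq_mul]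
      by_cases hza : z = a
      · rw [hza, hla', hma']
        ring
      by_cases hzb : z = b
      · rw [hzb, hlb, hmb]
        ring
      have h1 := hlG z hz.1
      have h2 := hmG z hz.1
      refine (mul_eq_zero.mp (?_ : (s * (l z * m' z) - r * (l' z * m z)) * (G z * G' z) = 0)
        ).resolve_right (mul_ne_zero (hGne z hz.1 hz.2 hza) (hGne' z hz.1 hz.2 hzb))
      linear_combination s * m' z * G' z * h1 - r * l' z * G' z * h2)
    (x + a) (Submodule.add_mem _ (Submodule.subset_span hxZ) (Submodule.subset_span haZ))
  simp only [Pi.sub_apply, Pi.mul_apply, Pi.smul_apply, smul_eq_mul, map_add, hlx, hlx', hla',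
    hma', add_zero, zero_add, zero_mul, mul_zero, sub_zero] at hzero
  exact mul_ne_zero hs (mul_ne_zero (hl a haZ hxa (Ne.symm hab))
    (hm' x hxZ (Ne.symm hxy) (Ne.symm hxa))) hzero

lemma InGeneralPosition.false_of_cayleyBacharach {d : ℕ} {Z : Finset V}
    (ih : ∀ i < d, ∀ Y : Finset V, Separated K Y → CayleyBacharach K i Y →
      Y.card + 1 ≤ 3 * i → OnTwoLines K Y ∨ OnPlaneConic K Y)
    (h : InGeneralPosition K Z) (hs : Separated K Z) (hZ : CayleyBacharach K d Z) (hd : 3 ≤ d)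
    (hcard : Z.card + 1 ≤ 3 * d) (hline : ¬ OnLine K Z) : False := by
  have hZc := hZ.le_card_of_not_onLine hs hline
  obtain ⟨n, rfl⟩ : ∃ n, d = n + 3 := ⟨d - 3, by omega⟩
  have hres : ∀ g ∈ formSpace K V (n + 2), ∀ T ⊆ Z, Z.card ≤ T.card + 3 → (∀ z ∈ T, g z = 0) →
      ∀ z ∈ Z, g z = 0 := by
    intro g hg T hT hTcard hgT
    by_contra! hcon
    obtain ⟨p, hp, hgp⟩ := hcon
    obtain ⟨Y, hYZ, hY, hYs, -, h1, h2⟩ := CayleyBacharach.exists_residual (m := 1) (k := n + 2)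
      (by rwa [show 1 + (n + 2) = n + 3 by omega]) hs hg hp hgp hT hgT
    have := h.card_le_two_of_onLine Y hYZ (hY.onLine hYs (by omega))
    omega
  have hZcard : Z.card = 3 * n + 8 := by
    by_contra hne
    obtain ⟨S, hSZ, hScard⟩ := Finset.exists_subset_card_eq
      (show min Z.card (3 * n + 5) ≤ Z.card from min_le_left _ _)
    obtain ⟨a, ha⟩ := Finset.card_pos.mp (show 0 < S.card by omega)
    obtain ⟨g, hg, hgS, hga⟩ := h.exists_form ih hs (i := n + 2) (by omega) hSZ (by omega) ha
    refine hga (hres g hg (S.erase a) ((Finset.erase_subset _ _).trans hSZ) ?_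
      (fun z hz => hgS z (Finset.mem_of_mem_erase hz) (Finset.ne_of_mem_erase hz)) a (hSZ ha))
    rw [Finset.card_erase_of_mem ha]
    omega
  let P : ℕ → Prop := fun j => ∀ g ∈ formSpace K V (j + 1), ∀ T ⊆ Z, 3 * j + 2 ≤ T.card →
    (∀ z ∈ T, g z = 0) → ∀ z ∈ Z, g z = 0
  have hPtop : P (n + 1) := fun g hg T hT hTcard => hres g hg T hT (by omega)
  have hP0 : ¬ P 0 := by
    intro hP
    obtain ⟨T, hT, hTcard⟩ := Finset.exists_subset_card_eq (show 3 ≤ Z.card by omega)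
    obtain ⟨a, b, c, hab, hac, hbc, rfl⟩ := Finset.card_eq_three.mp hTcard
    simp only [Finset.insert_subset_iff, Finset.singleton_subset_iff] at hT
    obtain ⟨ha, hb, hc⟩ := hT
    obtain ⟨l, hla, hlb, hl⟩ := h.exists_line ha hb hab
    refine hl c hc hac hbc (hP l (dual_mem_formSpace l) {a, b} (by
      simp [Finset.insert_subset_iff, ha, hb]) (by rw [Finset.card_pair hab]) ?_ c hc)
    simp [hla, hlb]
  obtain ⟨j, hjn, hPj, hPj'⟩ : ∃ j, j < n + 1 ∧ ¬ P j ∧ P (j + 1) := by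
    by_contra! hcon
    have : ∀ j ≤ n + 1, ¬ P j := by
      intro j
      induction j with
      | zero => exact fun _ => hP0
      | succ j ihj => exact fun hj => hcon j (by omega) (ihj (by omega))
    exact this (n + 1) le_rfl hPtop
  have hzeros : ∀ g ∈ formSpace K V (j + 1), ∀ T ⊆ Z, 3 * j + 3 ≤ T.card →
      (∀ z ∈ T, g z = 0) → ∀ z ∈ Z, g z = 0 := by
    intro g hg T hT hTcard hgT e he
    obtain ⟨T', hT'T, hT'card⟩ := Finset.exists_subset_card_eq hTcard
    by_contra hge
    have heT' : e ∉ T' := fun h' => hge (hgT e (hT'T h'))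
    obtain ⟨U, hU, hUcard⟩ : ∃ U ⊆ Z \ insert e T', U.card = 2 := by
      refine Finset.exists_subset_card_eq ?_
      have h1 := Finset.le_card_sdiff (insert e T') Z
      have h2 := Finset.card_insert_le e T'
      omega
    obtain ⟨x, y, hxy, rfl⟩ := Finset.card_eq_two.mp hUcard
    have hx := hU (Finset.mem_insert_self x {y})
    have hy := hU (Finset.mem_insert_of_mem (Finset.mem_singleton_self y))
    simp only [Finset.mem_sdiff, Finset.mem_insert, not_or] at hx hy
    obtain ⟨l, hlx, hly, hl⟩ := h.exists_line hx.1 hy.1 hxy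
    have h0 := hPj' _ (mul_mem_formSpace hg (dual_mem_formSpace l)) (insert x (insert y T'))
      (by simp [Finset.insert_subset_iff, hx.1, hy.1, hT'T.trans hT])
      (by
        rw [Finset.card_insert_of_notMem (by simp [hxy, hx.2.2]),
          Finset.card_insert_of_notMem hy.2.2]
        omega)
      (by
        intro z hz
        rw [Pi.mul_apply]
        simp only [Finset.mem_insert] at hz
        rcases hz with rfl | rfl | hz
        · rw [hlx, mul_zero]
        · rw [hly, mul_zero]
        · rw [hgT z (hT'T hz), zero_mul]) e he
    exact mul_ne_zero hge (hl e he hx.2.1 hy.2.1) h0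
  simp only [P, not_forall] at hPj
  obtain ⟨G, hG, T, hTZ, hTcard, hGT, p, hp, hGp⟩ := hPj
  obtain ⟨S, hST, hScard⟩ := Finset.exists_subset_card_eq hTcard
  have hSZ := hST.trans hTZ
  have hGS : ∀ z ∈ S, G z = 0 := fun z hz => hGT z (hST hz)
  have hGne : ∀ z ∈ Z, z ∉ S → G z ≠ 0 := fun z hz hzS hGz => hGp <|
    hzeros G hG (insert z S) (Finset.insert_subset hz hSZ)
      (by rw [Finset.card_insert_of_notMem hzS, hScard]) (by
        intro w hw
        rcases Finset.mem_insert.mp hw with rfl | hw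
        · exact hGz
        · exact hGS w hw) p hp
  obtain ⟨a, ha⟩ := Finset.card_pos.mp (show 0 < S.card by omega)
  obtain ⟨b, hb, hbS⟩ := Finset.exists_mem_notMem_of_card_lt_card (by omega : S.card < Z.card)
  obtain ⟨g, hg, hgS, hga⟩ := h.exists_form ih hs (i := j + 1) (by omega) hSZ (by omega) ha
  have hab : a ≠ b := fun hab => hbS (hab ▸ ha)
  have hform : G b • g - g b • G ∈ formSpace K V (j + 1) :=
    Submodule.sub_mem _ (Submodule.smul_mem _ _ hg) (Submodule.smul_mem _ _ hG)
  have hS₀ : ∀ z ∈ S.erase a, (G b • g - g b • G) z = 0 := by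
    intro z hz
    simp [hGS z (Finset.mem_of_mem_erase hz),
      hgS z (Finset.mem_of_mem_erase hz) (Finset.ne_of_mem_erase hz)]
  have hSe : (S.erase a).card + 1 = S.card := Finset.card_erase_add_one ha
  have hb0 : (G b • g - g b • G) b = 0 := by
    simp only [Pi.sub_apply, Pi.smul_apply, smul_eq_mul]
    ring
  have ha0 : (G b • g - g b • G) a ≠ 0 := by
    simp only [Pi.sub_apply, Pi.smul_apply, smul_eq_mul, hGS a ha, mul_zero, sub_zero]
    exact mul_ne_zero (hGne b hb hbS) hga
  refine h.false_of_forms hPj' (S := S.erase a) (hSZ ha) hb hab (Finset.notMem_erase a S)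
    (fun hb' => hbS (Finset.mem_of_mem_erase hb')) ((Finset.erase_subset _ _).trans hSZ)
    (by omega) (by omega) hG hform (fun z hz => hGS z (Finset.mem_of_mem_erase hz)) hS₀
    (hGS a ha) hb0 (fun z hz hzS hza => hGne z hz fun hz' => hzS (Finset.mem_erase.mpr ⟨hza, hz'⟩))
    fun z hz hzS hzb hz0 => ha0 <| hzeros _ hform (insert z (insert b (S.erase a)))
      (by
        simp only [Finset.insert_subset_iff]
        exact ⟨hz, hb, (Finset.erase_subset _ _).trans hSZ⟩)
      (by
        rw [Finset.card_insert_of_notMem (by simp only [Finset.mem_insert, not_or]; exact ⟨hzb, hzS⟩),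
          Finset.card_insert_of_notMem (fun hb' => hbS (Finset.mem_of_mem_erase hb'))]
        omega)
      (by
        intro w hw
        simp only [Finset.mem_insert] at hw
        rcases hw with rfl | rfl | hw
        · exact hz0
        · exact hb0
        · exact hS₀ w hw) a (hSZ ha)

lemma CayleyBacharach.inGeneralPosition {d : ℕ} {Z : Finset V}
    (ih : ∀ i < d, ∀ Y : Finset V, Separated K Y → CayleyBacharach K i Y →
      Y.card + 1 ≤ 3 * i → OnTwoLines K Y ∨ OnPlaneConic K Y)
    (hs : Separated K Z) (hZ : CayleyBacharach K d Z) (hd : 3 ≤ d)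
    (hcard : Z.card + 1 ≤ 3 * d) (hno : ¬ (OnTwoLines K Z ∨ OnPlaneConic K Z)) :
    InGeneralPosition K Z := by
  obtain ⟨n, rfl⟩ : ∃ n, d = n + 3 := ⟨d - 3, by omega⟩
  rw [not_or] at hno
  have hline : ¬ OnLine K Z := fun h => hno.1 h.onTwoLines
  have hZc := hZ.le_card_of_not_onLine hs hline
  have hsub : ∀ (W : Submodule K V), ∀ T ⊆ Z, (∀ z ∈ T, z ∈ W) → 3 ≤ T.card →
      ∀ z ∈ Z, z ∈ W := by
    intro W T hT hTW hTcard
    by_contra! h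
    obtain ⟨p, hp, hpW⟩ := h
    exact not_or.mpr hno (CayleyBacharach.onTwoLines_or_onPlaneConic_of_subspace (d := n + 1)
      (ih (n + 2) (by omega)) hs hZ hcard hp hpW hT hTW hTcard)
  have hcol : ∀ T ⊆ Z, OnLine K T → T.card ≤ 2 := by
    rintro T hT ⟨W, hW, hTW⟩
    by_contra! hTcard
    exact hline ⟨W, hW, hsub W T hT hTW hTcard⟩
  have hpl : ∀ a ∈ Z, ∀ b ∈ Z, ∀ c ∈ Z, a ≠ b → a ≠ c → b ≠ c →
      ∀ z ∈ Z, z ∈ Submodule.span K {a, b, c} := by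
    intro a ha b hb c hc hab hac hbc
    refine hsub _ {a, b, c} (by simp [Finset.insert_subset_iff, ha, hb, hc])
      (fun z hz => Submodule.subset_span (by simpa using hz))
      (Finset.card_eq_three.mpr ⟨a, b, c, hab, hac, hbc, rfl⟩).ge
  have hrank : finrank K (Submodule.span K (Z : Set V)) ≤ 3 := by
    obtain ⟨T, hT, hTcard⟩ := Finset.exists_subset_card_eq (show 3 ≤ Z.card by omega)
    have hle : Submodule.span K (Z : Set V) ≤ Submodule.span K T :=
      Submodule.span_le.mpr (hsub _ T hT (fun z hz => Submodule.subset_span hz) hTcard.ge)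
    exact (Submodule.finrank_mono hle).trans ((finrank_span_finset_le_card T).trans hTcard.le)
  have hconic : ∀ q ∈ formSpace K V 2, (∀ z ∈ Z, q z = 0) →
      ∀ x ∈ Submodule.span K (Z : Set V), q x = 0 := by
    intro q hq hqZ
    by_contra! h
    exact hno.2 ⟨hrank, q, hq, hqZ, h⟩
  refine ⟨hcol, hpl, fun q hq T hT hTcard hqT => hconic q hq ?_⟩
  by_contra! h
  obtain ⟨p, hp, hqp⟩ := h
  obtain ⟨Y, hYZ, hY, hYs, -, h1, h2⟩ :=
    CayleyBacharach.exists_residual (m := n + 1) hZ hs hq hp hqp hT hqT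
  have hYline : ¬ OnLine K Y := fun h => by
    have := hcol Y hYZ h
    omega
  have hYc := hY.le_card_of_not_onLine hYs hYline
  rcases ih (n + 1) (by omega) Y hYs hY (by omega) with
    ⟨W₁, W₂, hW₁, hW₂, hYW⟩ | ⟨-, q', hq', hqY', x, hx, hqx'⟩
  · have h1 := hcol (Y.filter (· ∈ W₁)) ((Finset.filter_subset _ _).trans hYZ)
      ⟨W₁, hW₁, fun z hz => (Finset.mem_filter.mp hz).2⟩
    have h2 := hcol (Y.filter (· ∈ W₂)) ((Finset.filter_subset _ _).trans hYZ)
      ⟨W₂, hW₂, fun z hz => (Finset.mem_filter.mp hz).2⟩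
    have h3 : Y.card ≤ (Y.filter (· ∈ W₁)).card + (Y.filter (· ∈ W₂)).card := by
      refine (Finset.card_le_card fun z hz => ?_).trans (Finset.card_union_le _ _)
      simpa [hz] using hYW z hz
    omega
  · by_cases hqZ' : ∀ z ∈ Z, q' z = 0
    · exact hqx' (hconic q' hq' hqZ' x (Submodule.span_mono (by exact_mod_cast hYZ) hx))
    · push Not at hqZ'
      obtain ⟨e, he, hqe⟩ := hqZ'
      obtain ⟨Y', hYZ', hY', hYs', -, h3, h4⟩ :=
        CayleyBacharach.exists_residual (m := n + 1) hZ hs hq' he hqe hYZ hqY'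
      have := hcol Y' hYZ' (hY'.onLine hYs' (by omega))
      omega

/-- A Cayley–Bacharach set of degree `d` with fewer than `3d` points lies on two lines or on a
plane conic. -/
theorem CayleyBacharach.onTwoLines_or_onPlaneConic (d : ℕ) :
    ∀ Z : Finset V, Separated K Z → CayleyBacharach K d Z → Z.card + 1 ≤ 3 * d →
      OnTwoLines K Z ∨ OnPlaneConic K Z := by
  induction d using Nat.strong_induction_on with
  | _ d ih =>
    intro Z hs hZ hcard
    by_contra hno
    have hline : ¬ OnLine K Z := fun h => hno (Or.inl h.onTwoLines)
    have hZc := hZ.le_card_of_not_onLine hs hline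
    have hd : 3 ≤ d := by omega
    exact (hZ.inGeneralPosition ih hs hd hcard hno).false_of_cayleyBacharach ih hs hZ hd hcard
      hline

lemma exists_bilinForm_of_mem_formSpace_two {q : V → K} (hq : q ∈ formSpace K V 2) :
    ∃ B : V →ₗ[K] V →ₗ[K] K, ∀ x, q x = B x x := by
  rw [formSpace, pow_two] at hq
  refine Submodule.mul_induction_on hq ?_ ?_
  · rintro _ ⟨φ, rfl⟩ _ ⟨ψ, rfl⟩
    exact ⟨(LinearMap.mul K K).compl₁₂ φ ψ, fun x => by simp⟩
  · rintro x y ⟨B, hB⟩ ⟨B', hB'⟩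
    exact ⟨B + B', fun v => by simp [hB, hB']⟩

lemma onTwoLines_of_coordinates {Z : Finset V} (a b c : V) {α β : K} (h : α ≠ 0 ∨ β ≠ 0)
    (hZ : ∀ z ∈ Z, ∃ x y w : K, z = x • a + y • b + w • c ∧ w * (β * x + α * y) = 0) :
    OnTwoLines K Z := by
  refine ⟨Submodule.span K {a, b}, Submodule.span K {c, α • a - β • b},
    finrank_span_pair_le _ _, finrank_span_pair_le _ _, fun z hz => ?_⟩
  obtain ⟨x, y, w, rfl, h0⟩ := hZ z hz
  rcases mul_eq_zero.mp h0 with rfl | h1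
  · exact Or.inl (Submodule.mem_span_pair.mpr ⟨x, y, by simp⟩)
  · refine Or.inr (Submodule.mem_span_pair.mpr ?_)
    by_cases hα : α = 0
    · subst hα
      have hβ : β ≠ 0 := by simpa using h
      have hx : x = 0 := by simpa [hβ] using h1
      refine ⟨w, -y / β, ?_⟩
      subst hx
      match_scalars <;> field_simp <;> simp
    · refine ⟨w, x / α, ?_⟩
      have hy : y = - (x / α * β) := by
        field_simp
        linear_combination h1
      rw [hy]
      match_scalars <;> field_simp

/-- A plane conic is contained in two lines, or is a smooth conic with its standard
parametrization. -/
lemma OnPlaneConic.onTwoLines_or_exists_parametrization [FiniteDimensional K V] {Z : Finset V}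
    (h : OnPlaneConic K Z) :
    OnTwoLines K Z ∨ ∃ u v w : V, LinearIndependent K ![u, v, w] ∧
      ∀ z ∈ Z, z ≠ 0 → ∃ s t : K, (s ≠ 0 ∨ t ≠ 0) ∧
        Submodule.span K {z} = Submodule.span K {s ^ 2 • u + (s * t) • v + t ^ 2 • w} := by
  by_cases hline : OnLine K Z
  · exact Or.inl hline.onTwoLines
  obtain ⟨hrank, q, hq, hqZ, x₀, hx₀, hqx₀⟩ := h
  have key : ∀ a b : V, ∃ p ∈ Z, p ∉ Submodule.span K {a, b} := by
    intro a b
    by_contra! h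
    exact hline ⟨_, finrank_span_pair_le a b, h⟩
  obtain ⟨a, ha, ha0⟩ := key 0 0
  obtain ⟨b, hb, hba⟩ := key a a
  obtain ⟨c, hc, hcab⟩ := key a b
  replace ha0 : a ≠ 0 := by
    rintro rfl
    exact ha0 (zero_mem _)
  rw [Set.pair_eq_singleton] at hba
  have hli : LinearIndependent K ![c, b, a] := by
    refine linearIndependent_finCons.mpr ⟨linearIndependent_finCons.mpr ⟨?_, ?_⟩, ?_⟩
    · exact LinearIndependent.of_subsingleton 0 ha0
    · simpa using hba
    · simpa [Set.pair_comm] using hcab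
  have hspan : Submodule.span K {a, b, c} = Submodule.span K (Z : Set V) := by
    refine Submodule.eq_of_le_of_finrank_le (Submodule.span_mono ?_) (hrank.trans ?_)
    · simp [Set.insert_subset_iff, ha, hb, hc]
    · have h1 := finrank_span_eq_card hli
      have h2 : Set.range ![c, b, a] = {a, b, c} := by
        ext v
        simp only [Matrix.range_cons, Matrix.range_empty, Set.mem_union, Set.mem_singleton_iff,
          Set.mem_insert_iff, Set.mem_empty_iff_false]
        tauto
      rw [h2] at h1
      simp [h1]
  have hli' : ∀ x y w : K, x • a + y • b + w • c = 0 → x = 0 ∧ y = 0 ∧ w = 0 := by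
    intro x y w h
    have h1 := Fintype.linearIndependent_iff.mp hli ![w, y, x] (by
      rw [Fin.sum_univ_three]
      simpa [add_comm, add_left_comm, add_assoc] using h)
    exact ⟨by simpa using h1 2, by simpa using h1 1, by simpa using h1 0⟩
  obtain ⟨B, hB⟩ := exists_bilinForm_of_mem_formSpace_two hq
  obtain ⟨α, hα⟩ : ∃ α, α = B b c + B c b := ⟨_, rfl⟩
  obtain ⟨β, hβ⟩ : ∃ β, β = B a c + B c a := ⟨_, rfl⟩
  obtain ⟨γ, hγ⟩ : ∃ γ, γ = B a b + B b a := ⟨_, rfl⟩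
  have hqc : ∀ x y w : K, q (x • a + y • b + w • c) = γ * x * y + β * x * w + α * y * w := by
    intro x y w
    have h1 : B a a = 0 := (hB a).symm.trans (hqZ a ha)
    have h2 : B b b = 0 := (hB b).symm.trans (hqZ b hb)
    have h3 : B c c = 0 := (hB c).symm.trans (hqZ c hc)
    rw [hB, hα, hβ, hγ]
    simp only [map_add, map_smul, LinearMap.add_apply, LinearMap.smul_apply, smul_eq_mul, h1, h2,
      h3]
    ring
  have hcoord : ∀ z ∈ Z, ∃ x y w : K, z = x • a + y • b + w • c ∧
      γ * x * y + β * x * w + α * y * w = 0 := by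
    intro z hz
    have hz' : z ∈ Submodule.span K {a, b, c} := hspan ▸ Submodule.subset_span hz
    obtain ⟨x, y, w, rfl⟩ := Submodule.mem_span_triple.mp hz'
    exact ⟨x, y, w, rfl, (hqc x y w).symm.trans (hqZ _ hz)⟩
  have hne : ¬ (α = 0 ∧ β = 0 ∧ γ = 0) := by
    rintro ⟨rfl, rfl, rfl⟩
    rw [← hspan] at hx₀
    obtain ⟨x, y, w, rfl⟩ := Submodule.mem_span_triple.mp hx₀
    exact hqx₀ (by rw [hqc]; ring)
  clear hα hβ hγ
  by_cases hγ : γ = 0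
  · refine Or.inl (onTwoLines_of_coordinates a b c (α := α) (β := β) (by tauto) fun z hz => ?_)
    obtain ⟨x, y, w, h1, h2⟩ := hcoord z hz
    exact ⟨x, y, w, h1, by linear_combination h2 - x * y * hγ⟩
  by_cases hβ : β = 0
  · refine Or.inl (onTwoLines_of_coordinates a c b (α := α) (β := γ) (by tauto) fun z hz => ?_)
    obtain ⟨x, y, w, h1, h2⟩ := hcoord z hz
    exact ⟨x, w, y, by rw [h1]; abel, by linear_combination h2 - x * w * hβ⟩
  by_cases hα : α = 0
  · refine Or.inl (onTwoLines_of_coordinates b c a (α := β) (β := γ) (by tauto) fun z hz => ?_)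
    obtain ⟨x, y, w, h1, h2⟩ := hcoord z hz
    exact ⟨y, w, x, by rw [h1]; abel, by linear_combination h2 - y * w * hα⟩
  refine Or.inr ⟨-β • b, -α • a - β • b + γ • c, -α • a, ?_, fun z hz hz0 => ?_⟩
  · refine Fintype.linearIndependent_iff.mpr fun g hg => ?_
    rw [Fin.sum_univ_three] at hg
    simp only [Matrix.cons_val_zero, Matrix.cons_val_one, Matrix.cons_val] at hg
    obtain ⟨h1, h2, h3⟩ := hli' (-α * (g 1 + g 2)) (-β * (g 0 + g 1)) (γ * g 1) (by
      rw [← hg]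
      module)
    have h4 : g 1 = 0 := by simpa [hγ] using h3
    have h5 : g 2 = 0 := by simpa [hα, h4] using h1
    have h6 : g 0 = 0 := by simpa [hβ, h4] using h2
    intro i
    fin_cases i
    · exact h6
    · exact h4
    · exact h5
  · obtain ⟨x, y, w, rfl, h2⟩ := hcoord z hz
    suffices ∃ s t : K, (s ≠ 0 ∨ t ≠ 0) ∧ ∃ k : K, k ≠ 0 ∧
        s ^ 2 • (-β • b) + (s * t) • (-α • a - β • b + γ • c) + t ^ 2 • (-α • a) =
          k • (x • a + y • b + w • c) by
      obtain ⟨s, t, hst, k, hk, heq⟩ := this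
      exact ⟨s, t, hst, by rw [heq, Submodule.span_singleton_smul_eq (IsUnit.mk0 k hk)]⟩
    by_cases hxy : x = 0 ∧ y = 0
    · obtain ⟨rfl, rfl⟩ := hxy
      have hw : w ≠ 0 := by
        rintro rfl
        simp at hz0
      refine ⟨1, -1, by simp, -γ / w, div_ne_zero (neg_ne_zero.mpr hγ) hw, ?_⟩
      match_scalars <;> field_simp <;> ring
    · have hD : α * y + β * x ≠ 0 := by
        intro hD
        have h3 : γ * (x * y) = 0 := by linear_combination h2 - w * hD
        rcases mul_eq_zero.mp ((mul_eq_zero.mp h3).resolve_left hγ) with rfl | rfl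
        · exact hxy ⟨rfl, by simpa [hα] using hD⟩
        · exact hxy ⟨by simpa [hβ] using hD, rfl⟩
      refine ⟨α * y, β * x, ?_, -(α * β * (α * y + β * x)),
        neg_ne_zero.mpr (mul_ne_zero (mul_ne_zero hα hβ) hD), ?_⟩
      · by_contra! h
        exact hD (by rw [h.1, h.2, add_zero])
      · match_scalars
        · ring
        · ring
        · linear_combination α * β * h2

end PlaneConfigurations

section Apolarity

open scoped Classical

variable {K : Type*} [Field K]

/-- Apolarity: every form `g` of degree `m` acts as a differential operator on polynomials, taking
the `m`-th power of the linear form with coefficient vector `v` to `m ! * g v`. -/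
lemma exists_differentialOperator {n m : ℕ} {g : (Fin n → K) → K}
    (hg : g ∈ formSpace K (Fin n → K) m) :
    ∃ D : MvPolynomial (Fin n) K →ₗ[K] MvPolynomial (Fin n) K, ∀ (v : Fin n → K) (k : ℕ),
      D ((∑ i, C (v i) * X i) ^ (k + m)) =
        (((k + m).descFactorial m : K) * g v) • (∑ i, C (v i) * X i) ^ k := by
  induction m generalizing g with
  | zero =>
    rw [formSpace, pow_zero] at hg
    obtain ⟨a, rfl⟩ := Submodule.mem_one.mp hg
    exact ⟨a • LinearMap.id, fun v k => by simp⟩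
  | succ m ih =>
    rw [formSpace, pow_succ'] at hg
    refine Submodule.mul_induction_on hg ?_ ?_
    · rintro _ ⟨φ, rfl⟩ h hh
      obtain ⟨D, hD⟩ := ih hh
      let E := mkDerivation K fun i : Fin n => (C (φ (Pi.single i 1)) : MvPolynomial (Fin n) K)
      have hE : ∀ v : Fin n → K, E (∑ i, C (v i) * X i) = C (φ v) := by
        intro v
        rw [map_sum, LinearMap.pi_apply_eq_sum_univ φ v, map_sum]
        refine Finset.sum_congr rfl fun i _ => ?_
        rw [← smul_eq_C_mul, Derivation.map_smul, mkDerivation_X, smul_eq_mul, C_mul,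
          smul_eq_C_mul]
        congr 3
        ext j
        simp [Pi.single_apply, eq_comm]
      refine ⟨D ∘ₗ E.toLinearMap, fun v k => ?_⟩
      have h1 : E ((∑ i, C (v i) * X i) ^ (k + m + 1)) =
          (((k + m + 1 : ℕ) : K) * φ v) • (∑ i, C (v i) * X i) ^ (k + m) := by
        rw [Derivation.leibniz_pow, hE, Nat.add_sub_cancel, mul_smul, smul_eq_mul,
          mul_comm (_ ^ _) (C _), ← smul_eq_C_mul, Nat.cast_smul_eq_nsmul]
      rw [LinearMap.comp_apply, ← add_assoc]
      erw [h1]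
      rw [map_smul, hD, smul_smul, Nat.succ_descFactorial_succ]
      congr 1
      simp only [Pi.mul_apply, LinearMap.ltoFun_apply]
      push_cast
      ring
    · rintro x y ⟨D, hD⟩ ⟨D', hD'⟩
      refine ⟨D + D', fun v k => ?_⟩
      rw [LinearMap.add_apply, hD, hD', ← add_smul, Pi.add_apply, mul_add]

end Apolarity

section Decompositions

open Module
open scoped Classical

variable {K : Type} [Field K] {r d : ℕ}

/-- An element of `S(f)` expresses `f` with nonzero coefficients, by minimality. -/
lemma exists_coeff_of_mem_decompSet {f : MvPolynomial (Fin (r + 1)) K}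
    {A : Finset (Projectivization K (Fin (r + 1) → K))} (hA : A ∈ decompSet K r d f) :
    ∃ a : Projectivization K (Fin (r + 1) → K) → K, (∀ p, a p ≠ 0 ↔ p ∈ A) ∧
      ∀ T, A ⊆ T → f = ∑ p ∈ T, a p • powForm K r d p := by
  obtain ⟨hfA, hcard⟩ := hA
  obtain ⟨c, hc⟩ : ∃ c : Projectivization K (Fin (r + 1) → K) → K,
      ∑ p ∈ A, c p • powForm K r d p = f := by
    obtain ⟨c, hc⟩ := (Submodule.mem_span_image_finset_iff_exists_fun K).mp hfA
    refine ⟨fun p => if hp : p ∈ A then c ⟨p, hp⟩ else 0, ?_⟩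
    rw [← hc, ← Finset.sum_coe_sort A]
    exact Finset.sum_congr rfl fun p _ => by simp
  have hne : ∀ p ∈ A, c p ≠ 0 := by
    intro p hp hcp
    have hmem : f ∈ decompSpan K r d ↑(A.erase p) := by
      rw [← hc, ← Finset.add_sum_erase A _ hp, hcp, zero_smul, zero_add]
      exact Submodule.sum_mem _ fun q hq =>
        Submodule.smul_mem _ _ (Submodule.subset_span ⟨q, hq, rfl⟩)
    have h1 : symRank K r d f ≤ (A.erase p).card := Nat.sInf_le ⟨_, rfl, hmem⟩
    have h2 := Finset.card_erase_lt_of_mem hp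
    omega
  refine ⟨fun p => if p ∈ A then c p else 0, fun p => ?_, fun T hT => ?_⟩
  · by_cases hp : p ∈ A
    · simpa [hp] using hne p hp
    · simp [hp]
  · rw [← Finset.sum_subset hT fun p _ hp => by simp [hp], ← hc]
    exact Finset.sum_congr rfl fun p hp => by simp [hp]

lemma rep_injective : Function.Injective
    (Projectivization.rep : Projectivization K (Fin (r + 1) → K) → Fin (r + 1) → K) := by
  intro p q h
  rw [← p.mk_rep, ← q.mk_rep]
  congr 1

lemma separated_image_rep (Z : Finset (Projectivization K (Fin (r + 1) → K))) :
    Separated K (Z.image Projectivization.rep) := by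
  intro u hu
  obtain ⟨p, -, rfl⟩ := Finset.mem_image.mp hu
  refine ⟨p.rep_nonzero, fun w hw hmem => ?_⟩
  obtain ⟨q, -, rfl⟩ := Finset.mem_image.mp hw
  obtain ⟨a, ha⟩ := Submodule.mem_span_singleton.mp hmem
  have : q = p := by
    rw [← p.mk_rep, ← q.mk_rep]
    exact (Projectivization.mk_eq_mk_iff' K _ _ q.rep_nonzero p.rep_nonzero).mpr ⟨a, ha⟩
  rw [this]

/-- A linear relation between `d`-th powers of linear forms is a Cayley–Bacharach relation of
degree `d` between the corresponding points. -/
lemma cayleyBacharach_of_relation [CharZero K]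
    {Z : Finset (Projectivization K (Fin (r + 1) → K))}
    {c : Projectivization K (Fin (r + 1) → K) → K} (hc : ∀ p ∈ Z, c p ≠ 0)
    (hrel : ∑ p ∈ Z, c p • powForm K r d p = 0) :
    CayleyBacharach K d (Z.image Projectivization.rep) := by
  refine ⟨Function.extend Projectivization.rep c 0, fun z hz => ?_, fun g hg => ?_⟩
  · obtain ⟨p, hp, rfl⟩ := Finset.mem_image.mp hz
    rw [rep_injective.extend_apply]
    exact hc p hp
  · obtain ⟨D, hD⟩ := exists_differentialOperator hg
    rw [Finset.sum_image rep_injective.injOn]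
    simp only [rep_injective.extend_apply]
    have h1 : D (∑ p ∈ Z, c p • powForm K r d p) =
        C ((d.factorial : K) * ∑ p ∈ Z, c p * g p.rep) := by
      rw [map_sum, Finset.mul_sum, map_sum]
      refine Finset.sum_congr rfl fun p _ => ?_
      have h2 := hD p.rep 0
      rw [zero_add, Nat.descFactorial_self, pow_zero] at h2
      rw [map_smul, powForm, h2, smul_smul, smul_eq_C_mul, mul_one]
      congr 1
      ring
    rw [hrel, map_zero] at h1
    exact (mul_eq_zero.mp (C_eq_zero.mp h1.symm)).resolve_left
      (Nat.cast_ne_zero.mpr d.factorial_ne_zero)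

lemma exists_le_and_finrank_eq {V : Type*} [AddCommGroup V] [Module K V] [FiniteDimensional K V]
    {n : ℕ} {W : Submodule K V} (hW : finrank K W ≤ n) (hn : n ≤ finrank K V) :
    ∃ W', W ≤ W' ∧ finrank K W' = n := by
  induction n, hW using Nat.le_induction with
  | base => exact ⟨W, le_rfl, rfl⟩
  | succ n _ ih =>
    obtain ⟨W', hle, hW'⟩ := ih (by omega)
    obtain ⟨v, -, hv⟩ := SetLike.exists_of_lt (Submodule.lt_top_of_finrank_lt_finrank (by omega) :
      W' < ⊤)
    refine ⟨W' ⊔ Submodule.span K {v}, hle.trans le_sup_left, ?_⟩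
    rw [Submodule.finrank_sup_span_singleton hv, hW']

lemma exists_isProjLine_of_finrank_le_two (hr : 2 ≤ r) {W : Submodule K (Fin (r + 1) → K)}
    (hW : finrank K W ≤ 2) : ∃ L, IsProjLine K r L ∧ ∀ p, p.rep ∈ W → p ∈ L := by
  obtain ⟨W', hle, hW'⟩ : ∃ W', W ≤ W' ∧ finrank K W' = 2 :=
    exists_le_and_finrank_eq hW (by rw [finrank_fin_fun]; omega)
  exact ⟨_, ⟨W', hW', rfl⟩, fun p hp => hle hp⟩

end Decompositions

/-- two distinct decompositions `A, B` of `f` (with `sr(f) = t`,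
`2t < 3d`, `r ≥ 2`) agree off a subset `Q` of `ℙ^r` which is a line, a union of
two lines, or a smooth conic; in particular `#(A ∩ Q) = #(B ∩ Q)`. -/
theorem stmt_10 {K : Type} [Field K] [IsAlgClosed K] [CharZero K]
    {r d t : ℕ} (hr : 2 ≤ r) (hd : 1 ≤ d) (ht : 0 < t) (htd : 2 * t < 3 * d)
    {f : MvPolynomial (Fin (r + 1)) K} (hf0 : f ≠ 0) (hfh : f.IsHomogeneous d)
    (hsr : symRank K r d f = t)
    {A B : Finset (Projectivization K (Fin (r + 1) → K))}
    (hA : A ∈ decompSet K r d f) (hB : B ∈ decompSet K r d f) (hAB : A ≠ B) :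
    ∃ Q : Set (Projectivization K (Fin (r + 1) → K)),
      (IsProjLine K r Q
        ∨ (∃ L₁ L₂, IsProjLine K r L₁ ∧ IsProjLine K r L₂ ∧ Q = L₁ ∪ L₂)
        ∨ IsSmoothConic K r Q)
      ∧ (↑A : Set (Projectivization K (Fin (r + 1) → K))) \ Q = ↑B \ Q
      ∧ ((↑A : Set (Projectivization K (Fin (r + 1) → K))) ∩ Q).ncard
          = ((↑B : Set (Projectivization K (Fin (r + 1) → K))) ∩ Q).ncard := by
  classical
  obtain ⟨a, ha, hfa⟩ := exists_coeff_of_mem_decompSet hA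
  obtain ⟨b, hb, hfb⟩ := exists_coeff_of_mem_decompSet hB
  have hAt : A.card = t := hA.2.trans hsr
  have hBt : B.card = t := hB.2.trans hsr
  let Z := (A ∪ B).filter fun p => a p - b p ≠ 0
  have hrel : ∑ p ∈ Z, (a p - b p) • powForm K r d p = 0 := by
    rw [Finset.sum_filter_of_ne fun p _ hp => left_ne_zero_of_smul hp]
    simp only [sub_smul, Finset.sum_sub_distrib]
    rw [← hfa _ Finset.subset_union_left, ← hfb _ Finset.subset_union_right, sub_self]
  have hCB := cayleyBacharach_of_relation (fun p hp => (Finset.mem_filter.mp hp).2) hrel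
  have hcard : (Z.image Projectivization.rep).card + 1 ≤ 3 * d := by
    have h1 : (Z.image Projectivization.rep).card ≤ Z.card := Finset.card_image_le
    have h2 : Z.card ≤ (A ∪ B).card := Finset.card_filter_le _ _
    have h3 := Finset.card_union_le A B
    omega
  obtain ⟨Q, hQ, hZQ⟩ : ∃ Q : Set (Projectivization K (Fin (r + 1) → K)),
      (IsProjLine K r Q
        ∨ (∃ L₁ L₂, IsProjLine K r L₁ ∧ IsProjLine K r L₂ ∧ Q = L₁ ∪ L₂)
        ∨ IsSmoothConic K r Q) ∧ ∀ p ∈ Z, p ∈ Q := by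
    have hmem : ∀ p ∈ Z, p.rep ∈ Z.image Projectivization.rep :=
      fun p hp => Finset.mem_image_of_mem _ hp
    rcases (hCB.onTwoLines_or_onPlaneConic d _ (separated_image_rep Z) hcard).elim Or.inl
      OnPlaneConic.onTwoLines_or_exists_parametrization with
      ⟨W₁, W₂, hW₁, hW₂, hZW⟩ | ⟨u, v, w, hli, hZ⟩
    · obtain ⟨L₁, hL₁, h1⟩ := exists_isProjLine_of_finrank_le_two hr hW₁
      obtain ⟨L₂, hL₂, h2⟩ := exists_isProjLine_of_finrank_le_two hr hW₂
      exact ⟨L₁ ∪ L₂, Or.inr (Or.inl ⟨L₁, L₂, hL₁, hL₂, rfl⟩),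
        fun p hp => (hZW _ (hmem p hp)).imp (h1 p) (h2 p)⟩
    · refine ⟨_, Or.inr (Or.inr ⟨u, v, w, hli, rfl⟩), fun p hp => ?_⟩
      obtain ⟨s, t, hst, h⟩ := hZ _ (hmem p hp) p.rep_nonzero
      exact ⟨s, t, hst, p.submodule_eq.trans h⟩
  have hoff : ∀ p ∉ Q, p ∈ A ↔ p ∈ B := by
    intro p hp
    have hab : p ∈ A ∪ B → a p = b p := fun hpAB => by
      by_contra hne
      exact hp (hZQ p (Finset.mem_filter.mpr ⟨hpAB, sub_ne_zero.mpr hne⟩))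
    constructor
    · intro hpA
      rw [← hb, ← hab (Finset.mem_union_left _ hpA), ha]
      exact hpA
    · intro hpB
      rw [← ha, hab (Finset.mem_union_right _ hpB), hb]
      exact hpB
  have hdiff : (↑A : Set (Projectivization K (Fin (r + 1) → K))) \ Q = ↑B \ Q := by
    ext p
    simp only [Set.mem_sdiff, Finset.mem_coe]
    exact ⟨fun h => ⟨(hoff p h.2).mp h.1, h.2⟩, fun h => ⟨(hoff p h.2).mpr h.1, h.2⟩⟩
  refine ⟨Q, hQ, hdiff, ?_⟩
  have h1 := Set.ncard_inter_add_ncard_sdiff_eq_ncard (↑A) Q A.finite_toSet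
  have h2 := Set.ncard_inter_add_ncard_sdiff_eq_ncard (↑B) Q B.finite_toSet
  rw [Set.ncard_coe_finset] at h1 h2
  rw [hdiff] at h1
  omega
end

section
/- Assume r ≥ 2 and d ≥ 3. Let f be a nonzero homogeneous polynomial of degree d in x_0,…,x_r over K and let A ∈ S(f). If there is a line D of ℙ^r such that 2·#(A ∩ D) ≥ d + 2, then S(f) is infinite: there are infinitely many pairwise non-identified decompositions of f. -/
open MvPolynomial

section Nodes

variable {K : Type} [Field K]

/-- A linear functional on polynomials is annihilated, up to degree `d`, by a nonzero polynomial of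
degree less than `k` as soon as there are fewer than `k` conditions. -/
theorem exists_ne_zero_degree_lt_map_mul_eq_zero {k d : ℕ} (L : Polynomial K →ₗ[K] K)
    (h : d + 2 ≤ 2 * k) :
    ∃ H : Polynomial K, H ≠ 0 ∧ H.degree < k ∧
      ∀ p : Polynomial K, p.natDegree + k ≤ d → L (H * p) = 0 := by
  let Φ : Polynomial.degreeLT K k →ₗ[K] (Fin (d + 1 - k) → K) :=
    LinearMap.pi fun m => L ∘ₗ LinearMap.mulRight K ((Polynomial.X : Polynomial K) ^ (m : ℕ)) ∘ₗ
      (Polynomial.degreeLT K k).subtype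
  have hfin : FiniteDimensional K (Polynomial.degreeLT K k) :=
    Module.Finite.equiv (Polynomial.degreeLTEquiv K k).symm
  have hrank : Module.finrank K (Fin (d + 1 - k) → K) <
      Module.finrank K (Polynomial.degreeLT K k) := by
    rw [(Polynomial.degreeLTEquiv K k).finrank_eq]
    simp only [Module.finrank_fin_fun]
    omega
  obtain ⟨H, hH, hne⟩ := (Submodule.ne_bot_iff _).1
    (LinearMap.ker_ne_bot_of_finrank_lt (f := Φ) hrank)
  refine ⟨H, fun h0 => hne (Subtype.ext h0), Polynomial.mem_degreeLT.1 H.2, fun p hp => ?_⟩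
  rw [p.as_sum_range_C_mul_X_pow, Finset.mul_sum, map_sum]
  refine Finset.sum_eq_zero fun m hm => ?_
  have hm' : m < d + 1 - k := by
    have := Finset.mem_range.1 hm
    omega
  have key : L ((H : Polynomial K) * Polynomial.X ^ m) = 0 :=
    congrFun (LinearMap.mem_ker.1 hH) ⟨m, hm'⟩
  rw [mul_left_comm, ← Polynomial.smul_eq_C_mul, map_smul, key, smul_zero]

/-- A functional that kills the multiples up to degree `d` of a polynomial with simple roots `S` is,
up to degree `d`, a combination of the evaluations at the points of `S`. -/
theorem exists_map_X_pow_eq_sum_of_map_nodal_mul {d : ℕ} (L : Polynomial K →ₗ[K] K) (S : Finset K)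
    (h : ∀ p : Polynomial K, p.natDegree + S.card ≤ d → L (Lagrange.nodal S id * p) = 0) :
    ∃ e : K → K, ∀ m ≤ d, L (Polynomial.X ^ m) = ∑ s ∈ S, e s * s ^ m := by
  classical
  refine ⟨fun s => L (Lagrange.basis S id s), fun m hm => ?_⟩
  set G : Polynomial K := Lagrange.nodal S id with hG
  have hmonic : G.Monic := Lagrange.nodal_monic
  have hdeg : G.degree = S.card := Lagrange.degree_nodal
  set p : Polynomial K := Polynomial.X ^ m with hp
  have hmod : L p = L (p %ₘ G) := by
    conv_lhs => rw [← Polynomial.modByMonic_add_div p G, map_add]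
    rcases lt_or_ge m S.card with hlt | hle
    · rw [(Polynomial.divByMonic_eq_zero_iff hmonic).2, mul_zero, map_zero, add_zero]
      rw [hdeg, hp, Polynomial.degree_X_pow]
      exact_mod_cast hlt
    · rw [h, add_zero]
      rw [Polynomial.natDegree_divByMonic _ hmonic, hp, Polynomial.natDegree_X_pow,
        Polynomial.natDegree_eq_of_degree_eq_some hdeg]
      omega
  have hlt : (p %ₘ G).degree < S.card := hdeg ▸ Polynomial.degree_modByMonic_lt p hmonic
  rw [hmod, Lagrange.eq_interpolate (v := id) (Set.injOn_id _) hlt, Lagrange.interpolate_apply,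
    map_sum]
  refine Finset.sum_congr rfl fun s hs => ?_
  have hroot : G.eval s = 0 := Lagrange.eval_nodal_at_node (v := id) hs
  have heval : (p %ₘ G).eval s = s ^ m := by
    have := congrArg (Polynomial.eval s) (Polynomial.modByMonic_add_div p G)
    simpa [hroot, hp] using this
  rw [id, heval, ← Polynomial.smul_eq_C_mul, map_smul, smul_eq_mul, mul_comm]

/-- In a pencil `G + s H` with `G` having only simple roots and `deg H < deg G`, only finitely many
members have a multiple root. -/
theorem finite_setOf_exists_multiple_root (T : Finset K) {H : Polynomial K} (hH : H ≠ 0)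
    (hdeg : H.degree < T.card) :
    {s : K | ∃ x, (Lagrange.nodal T id + Polynomial.C s * H).eval x = 0 ∧
      (Lagrange.nodal T id + Polynomial.C s * H).derivative.eval x = 0}.Finite := by
  classical
  set G : Polynomial K := Lagrange.nodal T id with hG
  have hsimple : ∀ x, G.eval x = 0 → G.derivative.eval x ≠ 0 := by
    intro x hx
    have hxT : x ∈ T := by
      by_contra hxT
      exact Lagrange.eval_nodal_not_at_node (v := id) (fun i hi (h : x = i) => hxT (h ▸ hi)) hx
    have hval := Lagrange.eval_nodal_derivative_eval_node_eq (v := id) hxT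
    rw [id] at hval
    rw [hG, hval]
    exact Lagrange.eval_nodal_not_at_node fun i hi (h : x = i) => (Finset.mem_erase.1 hi).1 h.symm
  set W : Polynomial K := G * H.derivative - G.derivative * H with hW
  have hW0 : W ≠ 0 := by
    intro hzero
    refine hH (Polynomial.eq_zero_of_degree_lt_of_eval_finset_eq_zero T hdeg fun x hx => ?_)
    have hGx : G.eval x = 0 := Lagrange.eval_nodal_at_node (v := id) hx
    have := congrArg (Polynomial.eval x) hzero
    simpa [hW, hGx, hsimple x hGx] using this
  refine ((W.roots.toFinset.image fun x => -G.eval x / H.eval x) ∪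
    W.roots.toFinset.image fun x =>
      -G.derivative.eval x / H.derivative.eval x).finite_toSet.subset ?_
  rintro s ⟨x, h1, h2⟩
  simp only [Polynomial.eval_add, Polynomial.eval_mul, Polynomial.eval_C, Polynomial.derivative_add,
    Polynomial.derivative_mul, Polynomial.derivative_C, zero_mul, zero_add] at h1 h2
  have hx : x ∈ W.roots.toFinset := by
    rw [Multiset.mem_toFinset, Polynomial.mem_roots hW0, Polynomial.IsRoot, hW]
    simp only [Polynomial.eval_sub, Polynomial.eval_mul]
    linear_combination H.derivative.eval x * h1 - H.eval x * h2
  simp only [Finset.coe_union, Finset.coe_image, Set.mem_union, Set.mem_image, Finset.mem_coe]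
  by_cases hHx : H.eval x = 0
  · have hGx : G.eval x = 0 := by simpa [hHx] using h1
    have hHx' : H.derivative.eval x ≠ 0 := fun h0 => hsimple x hGx (by simpa [h0] using h2)
    refine Or.inr ⟨x, hx, ?_⟩
    rw [div_eq_iff hHx']
    linear_combination -h2
  · refine Or.inl ⟨x, hx, ?_⟩
    rw [div_eq_iff hHx]
    linear_combination -h1

/-- The moments up to degree `d` of a weighted set of `k` nodes, `2 k ≥ d + 2`, are those of
infinitely many weighted sets of `k` nodes. -/
theorem infinite_setOf_same_moments [IsAlgClosed K] {d : ℕ} (T : Finset K) (c : K → K)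
    (h : d + 2 ≤ 2 * T.card) :
    {S : Finset K | S.card = T.card ∧ ∃ e : K → K, ∀ m ≤ d,
      ∑ t ∈ T, c t * t ^ m = ∑ s ∈ S, e s * s ^ m}.Infinite := by
  classical
  let L : Polynomial K →ₗ[K] K := ∑ t ∈ T, c t • Polynomial.leval t
  have hL : ∀ p, L p = ∑ t ∈ T, c t * p.eval t := fun p => by simp [L, Polynomial.leval]
  obtain ⟨H, hH0, hHdeg, hH⟩ := exists_ne_zero_degree_lt_map_mul_eq_zero L h
  set G : Polynomial K := Lagrange.nodal T id with hG
  have hGdeg : G.degree = T.card := Lagrange.degree_nodal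
  have hltdeg : ∀ s : K, (Polynomial.C s * H).degree < G.degree := fun s => by
    rw [hGdeg, ← Polynomial.smul_eq_C_mul]
    exact (Polynomial.degree_smul_le s H).trans_lt hHdeg
  have hmonic : ∀ s, (G + Polynomial.C s * H).Monic := fun s =>
    Polynomial.Monic.add_of_left Lagrange.nodal_monic (hltdeg s)
  have hnat : ∀ s, (G + Polynomial.C s * H).natDegree = T.card := fun s =>
    Polynomial.natDegree_eq_of_degree_eq_some
      ((Polynomial.degree_add_eq_left_of_degree_lt (hltdeg s)).trans hGdeg)
  have hroots : ∀ s ∉ {s : K | ∃ x, (G + Polynomial.C s * H).eval x = 0 ∧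
      (G + Polynomial.C s * H).derivative.eval x = 0},
      (G + Polynomial.C s * H).roots.Nodup := by
    intro s hs
    rw [Multiset.nodup_iff_count_le_one]
    intro x
    rw [Polynomial.count_roots]
    by_contra! hx
    rw [Polynomial.one_lt_rootMultiplicity_iff_isRoot (hmonic s).ne_zero] at hx
    exact hs ⟨x, hx.1, hx.2⟩
  have hnodal : ∀ s ∉ {s : K | ∃ x, (G + Polynomial.C s * H).eval x = 0 ∧
      (G + Polynomial.C s * H).derivative.eval x = 0},
      Lagrange.nodal (G + Polynomial.C s * H).roots.toFinset id = G + Polynomial.C s * H := by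
    intro s hs
    conv_rhs => rw [(IsAlgClosed.splits (G + Polynomial.C s * H)).eq_prod_roots_of_monic (hmonic s)]
    rw [Lagrange.nodal, Finset.prod, Multiset.toFinset_val, (hroots s hs).dedup]
    rfl
  refine Set.infinite_of_injOn_mapsTo (f := fun s => (G + Polynomial.C s * H).roots.toFinset)
    ?_ ?_ (finite_setOf_exists_multiple_root T hH0 hHdeg).infinite_compl
  · intro s hs s' hs' hss
    have heq : G + Polynomial.C s * H = G + Polynomial.C s' * H := by
      rw [← hnodal s hs, ← hnodal s' hs']
      exact congrArg (fun S => Lagrange.nodal S id) hss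
    exact Polynomial.C_injective (mul_right_cancel₀ hH0 (add_left_cancel heq))
  · intro s hs
    have hcard : (G + Polynomial.C s * H).roots.toFinset.card = T.card := by
      rw [Multiset.toFinset_card_of_nodup (hroots s hs), ← hnat s]
      exact (IsAlgClosed.splits _).natDegree_eq_card_roots.symm
    refine ⟨hcard, ?_⟩
    have hkill : ∀ p : Polynomial K,
        p.natDegree + (G + Polynomial.C s * H).roots.toFinset.card ≤ d →
        L (Lagrange.nodal (G + Polynomial.C s * H).roots.toFinset id * p) = 0 := by
      intro p hp
      rw [hcard] at hp
      rw [hnodal s hs, add_mul, mul_assoc, ← Polynomial.smul_eq_C_mul, map_add, map_smul, hH p hp,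
        smul_zero, add_zero, hL]
      refine Finset.sum_eq_zero fun t ht => ?_
      have : G.eval t = 0 := Lagrange.eval_nodal_at_node (v := id) ht
      simp [this]
    obtain ⟨e, he⟩ := exists_map_X_pow_eq_sum_of_map_nodal_mul L _ hkill
    refine ⟨e, fun m hm => ?_⟩
    rw [← he m hm, hL]
    simp

end Nodes

section Line

variable {K : Type} [Field K]

/-- Finitely many points of a projective line lie in an affine chart of it. -/
theorem exists_linearIndependent_forall_eq_mk [Infinite K] {V : Type*} [AddCommGroup V] [Module K V]
    {W : Submodule K V} (hW : Module.finrank K W = 2) (A : Finset (Projectivization K V))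
    (hA : ∀ p ∈ A, p.rep ∈ W) :
    ∃ u ∈ W, ∃ v ∈ W, LinearIndependent K ![u, v] ∧
      ∀ p ∈ A, ∃ t a : K, a ≠ 0 ∧ a • (u + t • v) = p.rep := by
  classical
  have hfin : FiniteDimensional K W := Module.finite_of_finrank_pos (by omega)
  let b := Module.finBasisOfFinrankEq K W hW
  let x : V := b 0
  let y : V := b 1
  have hxy : LinearIndependent K ![x, y] := by
    have := b.linearIndependent.map' W.subtype W.ker_subtype
    have heq : W.subtype ∘ b = ![x, y] := by
      ext i
      fin_cases i <;> rfl
    rwa [heq] at this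
  have hrep : ∀ p ∈ A, ∃ α β : K, α • x + β • y = p.rep := fun p hp => by
    have := congrArg W.subtype (b.sum_repr ⟨p.rep, hA p hp⟩)
    rw [Fin.sum_univ_two] at this
    exact ⟨_, _, this⟩
  choose! α β hαβ using hrep
  obtain ⟨l, hl⟩ := Infinite.exists_notMem_finset (A.image fun p => -α p / β p)
  have hne : ∀ p ∈ A, α p + l * β p ≠ 0 := by
    intro p hp h0
    by_cases hβ : β p = 0
    · have hα : α p = 0 := by simpa [hβ] using h0
      have := hαβ p hp
      rw [hα, hβ, zero_smul, zero_smul, add_zero] at this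
      exact p.rep_nonzero this.symm
    · refine hl (Finset.mem_image.2 ⟨p, hp, ?_⟩)
      rw [div_eq_iff hβ]
      linear_combination -h0
  refine ⟨x, (b 0).2, y - l • x, W.sub_mem (b 1).2 (W.smul_mem _ (b 0).2), ?_, fun p hp => ?_⟩
  · rw [LinearIndependent.pair_iff] at hxy ⊢
    intro s t hst
    have := hxy (s - t * l) t (by rw [← hst]; module)
    obtain ⟨h1, h2⟩ := this
    subst h2
    simpa using h1
  · refine ⟨β p / (α p + l * β p), α p + l * β p, hne p hp, ?_⟩
    rw [smul_add, smul_smul, mul_div_cancel₀ _ (hne p hp), ← hαβ p hp]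
    module

end Line

/-- The linear form with a given vector of coefficients. -/
noncomputable def linearFormOfVec (K : Type) [Field K] (r : ℕ) :
    (Fin (r + 1) → K) →ₗ[K] MvPolynomial (Fin (r + 1)) K :=
  Fintype.linearCombination K MvPolynomial.X

theorem powForm_eq_linearFormOfVec_pow {K : Type} [Field K] {r d : ℕ}
    (p : Projectivization K (Fin (r + 1) → K)) :
    powForm K r d p = linearFormOfVec K r p.rep ^ d := by
  simp [powForm, linearFormOfVec, Fintype.linearCombination_apply, MvPolynomial.smul_eq_C_mul]

/-- Equality of moments up to degree `d` gives equality of the sums of `d`-th powers. -/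
theorem sum_smul_add_smul_pow_congr {K R : Type*} [CommSemiring K] [CommSemiring R] [Algebra K R]
    {d : ℕ} {S T : Finset K} {c e : K → K}
    (h : ∀ m ≤ d, ∑ t ∈ T, c t * t ^ m = ∑ s ∈ S, e s * s ^ m) (x y : R) :
    ∑ t ∈ T, c t • (x + t • y) ^ d = ∑ s ∈ S, e s • (x + s • y) ^ d := by
  have key : ∀ (U : Finset K) (g : K → K), ∑ t ∈ U, g t • (x + t • y) ^ d =
      ∑ m ∈ Finset.range (d + 1),
        (∑ t ∈ U, g t * t ^ m) • (y ^ m * x ^ (d - m) * (d.choose m : R)) := by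
    intro U g
    simp_rw [Finset.sum_smul]
    rw [Finset.sum_comm]
    refine Finset.sum_congr rfl fun t _ => ?_
    rw [add_comm x, add_pow, Finset.smul_sum]
    refine Finset.sum_congr rfl fun m _ => ?_
    rw [smul_pow, smul_mul_assoc, smul_mul_assoc, smul_smul]
  rw [key, key]
  exact Finset.sum_congr rfl fun m hm => by rw [h m (Nat.lt_succ_iff.1 (Finset.mem_range.1 hm))]

/-- if a decomposition `A ∈ S(f)` meets a line `D` in at least
`⌈(d+2)/2⌉` points (i.e. `2·#(A ∩ D) ≥ d + 2`), then `S(f)` is infinite. -/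
theorem stmt_12 {K : Type} [Field K] [IsAlgClosed K] [CharZero K]
    {r d : ℕ} (hr : 2 ≤ r) (hd : 3 ≤ d)
    {f : MvPolynomial (Fin (r + 1)) K} (hf0 : f ≠ 0) (hfh : f.IsHomogeneous d)
    {A : Finset (Projectivization K (Fin (r + 1) → K))}
    (hA : A ∈ decompSet K r d f)
    {D : Set (Projectivization K (Fin (r + 1) → K))} (hD : IsProjLine K r D)
    (hcard : d + 2 ≤
      2 * ((↑A : Set (Projectivization K (Fin (r + 1) → K))) ∩ D).ncard) :
    (decompSet K r d f).Infinite := by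
  classical
  obtain ⟨W, hW, rfl⟩ := hD
  obtain ⟨hfA, hAcard⟩ := hA
  set A₁ := A.filter fun p => p.rep ∈ W with hA₁
  set A₂ := A.filter fun p => ¬ p.rep ∈ W with hA₂
  have hinter : (A : Set (Projectivization K (Fin (r + 1) → K))) ∩ {p | p.rep ∈ W} = A₁ := by
    ext p
    simp [hA₁]
  rw [hinter, Set.ncard_coe_finset] at hcard
  obtain ⟨u, hu, v, hv, huv, hchart⟩ := exists_linearIndependent_forall_eq_mk hW A₁
    fun p hp => (Finset.mem_filter.1 hp).2
  rw [LinearIndependent.pair_iff] at huv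
  have hne : ∀ t : K, u + t • v ≠ 0 := fun t h0 =>
    one_ne_zero (huv 1 t (by rwa [one_smul])).1
  let q : K → Projectivization K (Fin (r + 1) → K) := fun t => Projectivization.mk K _ (hne t)
  have hq : Function.Injective q := by
    intro s t hst
    obtain ⟨a, ha⟩ := (Projectivization.mk_eq_mk_iff' K _ _ (hne s) (hne t)).1 hst
    have := huv (a - 1) (a * t - s) (by
      rw [sub_smul, sub_smul, mul_smul, one_smul, sub_add_sub_comm, ← smul_add, ha, sub_self])
    obtain ⟨h1, h2⟩ := this
    rw [sub_eq_zero] at h1 h2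
    rw [← h2, h1, one_mul]
  have hqrep : ∀ t, ∃ b : K, b ≠ 0 ∧ (q t).rep = b • (u + t • v) := by
    intro t
    obtain ⟨b, hb⟩ := Projectivization.exists_smul_eq_mk_rep K _ (hne t)
    exact ⟨b, b.ne_zero, hb.symm⟩
  choose b hb0 hb using hqrep
  have hpow : ∀ t, powForm K r d (q t) =
      b t ^ d • (linearFormOfVec K r u + t • linearFormOfVec K r v) ^ d := fun t => by
    rw [powForm_eq_linearFormOfVec_pow, hb, map_smul, map_add, map_smul, smul_pow]
  obtain ⟨T, hT⟩ : ∃ T : Finset K, T.image q = A₁ := by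
    refine ⟨A₁.preimage q hq.injOn, ?_⟩
    rw [Finset.image_preimage, Finset.filter_eq_self]
    intro p hp
    obtain ⟨t, a, ha, hta⟩ := hchart p hp
    refine ⟨t, ?_⟩
    rw [← p.mk_rep]
    exact ((Projectivization.mk_eq_mk_iff' K _ _ p.rep_nonzero (hne t)).2 ⟨a, hta⟩).symm
  have hTcard : T.card = A₁.card := by rw [← hT, Finset.card_image_of_injective _ hq]
  obtain ⟨c, hc⟩ : ∃ c : Projectivization K (Fin (r + 1) → K) → K,
      ∑ p ∈ A, c p • powForm K r d p = f :=
    (Submodule.mem_span_image_finset_iff_exists_fun' K).1 hfA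
  have hsplit : f = ∑ p ∈ A₂, c p • powForm K r d p + ∑ t ∈ T, (c (q t) * b t ^ d) •
      (linearFormOfVec K r u + t • linearFormOfVec K r v) ^ d := by
    rw [← hc, ← Finset.sum_filter_add_sum_filter_not A (fun p => p.rep ∈ W),
      add_comm (∑ p ∈ A with p.rep ∈ W, c p • powForm K r d p)]
    rw [← hA₁, ← hA₂, ← hT, Finset.sum_image hq.injOn]
    refine congrArg (_ + ·) ?_
    exact Finset.sum_congr rfl fun t _ => by rw [hpow, smul_smul]
  have hqW : ∀ t, (q t).rep ∈ W := fun t => by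
    rw [hb]
    exact W.smul_mem _ (W.add_mem hu (W.smul_mem _ hv))
  rw [← hTcard] at hcard
  refine Set.infinite_of_injOn_mapsTo (f := fun S => A₂ ∪ S.image q) ?_ ?_
    (infinite_setOf_same_moments T (fun t => c (q t) * b t ^ d) hcard)
  · intro S _ S' _ hSS
    have hfilter : ∀ S : Finset K,
        (A₂ ∪ S.image q).filter (fun p => p.rep ∈ W) = S.image q := by
      intro S
      ext p
      simp only [hA₂, Finset.mem_filter, Finset.mem_union, Finset.mem_image]
      constructor
      · rintro ⟨h | h, hp⟩
        · exact absurd hp h.2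
        · exact h
      · rintro ⟨t, ht, rfl⟩
        exact ⟨Or.inr ⟨t, ht, rfl⟩, hqW t⟩
    have := congrArg (Finset.filter fun p => p.rep ∈ W) hSS
    simp only [hfilter] at this
    exact Finset.image_injective hq this
  · rintro S ⟨hScard, e, he⟩
    have hmem : f ∈ decompSpan K r d ↑(A₂ ∪ S.image q) := by
      rw [hsplit, sum_smul_add_smul_pow_congr he]
      refine Submodule.add_mem _ (Submodule.sum_mem _ fun p hp => Submodule.smul_mem _ _ ?_)
        (Submodule.sum_mem _ fun s hs => Submodule.smul_mem _ _ ?_)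
      · exact Submodule.subset_span ⟨p, by simp [hp], rfl⟩
      · rw [← Submodule.smul_mem_iff _ (pow_ne_zero d (hb0 s)), ← hpow]
        exact Submodule.subset_span ⟨q s, by
          simpa using Or.inr ⟨s, hs, rfl⟩, rfl⟩
    refine ⟨hmem, le_antisymm ?_ (Nat.sInf_le ⟨_, rfl, hmem⟩)⟩
    rw [← hAcard, ← Finset.card_filter_add_card_filter_not (s := A) (fun p => p.rep ∈ W),
      ← hA₁, ← hA₂, ← hTcard, ← hScard, add_comm S.card]
    exact (Finset.card_union_le _ _).trans (Nat.add_le_add_left Finset.card_image_le _)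
end

section
/- Assume r ≥ 2 and d ≥ 3. Let f be a nonzero homogeneous polynomial of degree d in x_0,…,x_r over K and let A ∈ S(f). If there is a smooth conic T of ℙ^r such that #(A ∩ T) ≥ d + 1, then S(f) is infinite: there are infinitely many pairwise non-identified decompositions of f. -/
open MvPolynomial

namespace Polynomial

/-- In the pencil spanned by a separable polynomial `h₀` and a nonzero polynomial `h₁` of smaller
degree, all but finitely many members are separable. -/
lemma finite_not_separable_pencil {K : Type*} [Field K] [IsAlgClosed K]
    {h₀ h₁ : K[X]} (hsep : h₀.Separable) (hne : h₁ ≠ 0) (hdeg : h₁.degree < h₀.degree) :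
    {a : K | ¬ (h₀ + C a * h₁).Separable}.Finite := by
  classical
  set W : K[X] := derivative h₀ * h₁ - h₀ * derivative h₁ with hW
  have hW0 : W ≠ 0 := by
    intro h
    have hdvd : h₀ ∣ derivative h₀ * h₁ := ⟨derivative h₁, sub_eq_zero.mp h⟩
    have hdvd' : h₀ ∣ h₁ := hsep.dvd_of_dvd_mul_left hdvd
    exact absurd (degree_le_of_dvd hdvd' hne) (not_le.mpr hdeg)
  refine ((W.roots.toFinset.image fun y => -h₀.eval y / h₁.eval y) ∪
    (W.roots.toFinset.image fun y =>
      -(derivative h₀).eval y / (derivative h₁).eval y)).finite_toSet.subset ?_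
  intro a ha
  have ha' : ∃ y, (h₀ + C a * h₁).eval y = 0 ∧ (derivative (h₀ + C a * h₁)).eval y = 0 := by
    by_contra hcon
    push Not at hcon
    refine ha ?_
    rw [Polynomial.Separable]
    refine (isCoprime_iff_aeval_ne_zero_of_isAlgClosed K K _ _).mpr fun y => ?_
    simp only [coe_aeval_eq_eval]
    by_cases hy : (h₀ + C a * h₁).eval y = 0
    · exact Or.inr (hcon y hy)
    · exact Or.inl hy
  obtain ⟨y, h1, h2⟩ := ha'
  simp only [eval_add, eval_mul, eval_C, derivative_add, derivative_mul, derivative_C, zero_mul,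
    zero_add] at h1 h2
  have hy : y ∈ W.roots.toFinset := by
    rw [Multiset.mem_toFinset, mem_roots hW0, IsRoot.def, hW]
    simp only [eval_sub, eval_mul]
    linear_combination h₁.eval y * h2 - (derivative h₁).eval y * h1
  simp only [Finset.coe_union, Finset.coe_image, Set.mem_union, Set.mem_image, Finset.mem_coe]
  by_cases hz : h₁.eval y = 0
  · right
    refine ⟨y, hy, ?_⟩
    have h0 : h₀.eval y = 0 := by simpa [hz] using h1
    have hd0 : (derivative h₀).eval y ≠ 0 := by
      simpa using hsep.eval₂_derivative_ne_zero (RingHom.id K) h0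
    have hd1 : (derivative h₁).eval y ≠ 0 := by
      intro h
      apply hd0
      simpa [h] using h2
    field_simp
    linear_combination -h2
  · left
    refine ⟨y, hy, ?_⟩
    field_simp
    linear_combination -h1

/-- A functional on polynomials of degree `< N` that kills the multiples of a monic polynomial with
simple roots is a combination of the evaluations at these roots. -/
lemma exists_eval_combination {K : Type*} [Field K] {N : ℕ} (L : K[X] →ₗ[K] K) (Y : Finset K)
    (hL : ∀ j, j + Y.card < N → L (X ^ j * ∏ y ∈ Y, (X - C y)) = 0) :
    ∃ c : K → K, ∀ p : K[X], p.degree < N → L p = ∑ y ∈ Y, c y * p.eval y := by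
  classical
  set h : K[X] := ∏ y ∈ Y, (X - C y) with hh
  have hmon : h.Monic := monic_prod_of_monic _ _ fun y _ => monic_X_sub_C y
  have hnat : h.natDegree = Y.card := by simp [hh]
  have hhdeg : h.degree = Y.card := by rw [degree_eq_natDegree hmon.ne_zero, hnat]
  refine ⟨fun y => L (Lagrange.basis Y id y), fun p hp => ?_⟩
  have hmod : p %ₘ h = Lagrange.interpolate Y id fun y => p.eval y := by
    refine Lagrange.eq_interpolate_of_eval_eq (v := id) _ (Set.injOn_id _) ?_ ?_
    · rw [← hhdeg]
      exact degree_modByMonic_lt _ hmon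
    · intro y hy
      have hr : h.eval y = 0 := by
        rw [hh, eval_prod]
        exact Finset.prod_eq_zero hy (by simp)
      have := congrArg (eval y) (modByMonic_add_div p h)
      simpa [hr] using this
  have hdiv : L (h * (p /ₘ h)) = 0 := by
    rw [(p /ₘ h).as_sum_range, Finset.mul_sum, map_sum]
    refine Finset.sum_eq_zero fun j hj => ?_
    by_cases hq : p /ₘ h = 0
    · simp [hq]
    rw [← C_mul_X_pow_eq_monomial,
      show h * (C ((p /ₘ h).coeff j) * X ^ j) = (p /ₘ h).coeff j • (X ^ j * h) by
        rw [smul_eq_C_mul]; ring, map_smul, hL j, smul_zero]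
    have hle : h.degree ≤ p.degree := by
      by_contra hlt
      exact hq ((divByMonic_eq_zero_iff hmon).mpr (not_le.mp hlt))
    have hp0 : p ≠ 0 := by rintro rfl; simp at hq
    have h1 := natDegree_divByMonic p hmon
    have h2 : h.natDegree ≤ p.natDegree := natDegree_le_natDegree hle
    have h3 : p.natDegree < N := (natDegree_lt_iff_degree_lt hp0).mpr hp
    have h4 := Finset.mem_range.mp hj
    omega
  conv_lhs => rw [← modByMonic_add_div p h]
  rw [map_add, hdiv, add_zero, hmod, Lagrange.interpolate_apply, map_sum]
  refine Finset.sum_congr rfl fun y _ => ?_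
  rw [← smul_eq_C_mul, map_smul, smul_eq_mul, mul_comm]

/-- A point in the span of `b` points of a moment curve in `K^N` with `N < 2b` lies in the span of
infinitely many `b`-tuples of points of that curve. -/
lemma infinite_moment_decompositions {K : Type*} [Field K] [IsAlgClosed K] {N : ℕ}
    (Z : Finset K) (c : K → K) (hN : N < 2 * Z.card) :
    {Y : Finset K | Y.card = Z.card ∧ ∃ c' : K → K, ∀ k < N,
      ∑ z ∈ Z, c z * z ^ k = ∑ y ∈ Y, c' y * y ^ k}.Infinite := by
  classical
  have : Infinite K := IsAlgClosed.instInfinite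
  set b := Z.card with hb
  let L : K[X] →ₗ[K] K := ∑ z ∈ Z, c z • Polynomial.leval z
  have hLdef (p : K[X]) : L p = ∑ z ∈ Z, c z * p.eval z := by simp [L, leval]
  set h₀ : K[X] := ∏ z ∈ Z, (X - C z) with hh₀
  have hmon : h₀.Monic := monic_prod_of_monic _ _ fun y _ => monic_X_sub_C y
  have hdeg₀ : h₀.degree = b := by
    rw [degree_eq_natDegree hmon.ne_zero]; simp [hh₀, hb]
  have hsep : h₀.Separable :=
    separable_prod_X_sub_C_iff'.mpr fun _ _ _ _ h => h
  have hL₀ (q : K[X]) : L (q * h₀) = 0 := by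
    rw [hLdef]
    refine Finset.sum_eq_zero fun z hz => ?_
    have : h₀.eval z = 0 := by
      rw [hh₀, eval_prod]
      exact Finset.prod_eq_zero hz (by simp)
    simp [this]
  obtain ⟨h₁, hne, hdeg₁, hL₁⟩ : ∃ h₁ : K[X], h₁ ≠ 0 ∧ h₁.degree < b ∧
      ∀ j, j + b < N → L (X ^ j * h₁) = 0 := by
    let Φ : degreeLT K b →ₗ[K] (Fin (N - b) → K) :=
      LinearMap.pi fun j => L ∘ₗ LinearMap.mulLeft K (X ^ (j : ℕ)) ∘ₗ (degreeLT K b).subtype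
    have hfin : Module.finrank K (degreeLT K b) = b := by
      rw [(degreeLTEquiv K b).finrank_eq]; simp
    have : Module.Finite K (degreeLT K b) := Module.Finite.equiv (degreeLTEquiv K b).symm
    have hker : LinearMap.ker Φ ≠ ⊥ := by
      refine LinearMap.ker_ne_bot_of_finrank_lt ?_
      rw [hfin, Module.finrank_fin_fun]
      omega
    obtain ⟨q, hq, hq0⟩ := Submodule.exists_mem_ne_zero_of_ne_bot hker
    refine ⟨q, by simpa using hq0, mem_degreeLT.mp q.2, fun j hj => ?_⟩
    have := congrFun (LinearMap.mem_ker.mp hq) ⟨j, by omega⟩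
    simpa [Φ] using this
  have hlt (a : K) : (C a * h₁).degree < h₀.degree := by
    rw [hdeg₀]
    refine lt_of_le_of_lt ?_ hdeg₁
    rw [← smul_eq_C_mul]
    exact degree_smul_le a h₁
  have hmonic (a : K) : (h₀ + C a * h₁).Monic := hmon.add_of_left (hlt a)
  have hgood := (finite_not_separable_pencil hsep hne (hdeg₀ ▸ hdeg₁)).infinite_compl
  have hprod (a : K) (ha : (h₀ + C a * h₁).Separable) :
      ∏ y ∈ (h₀ + C a * h₁).roots.toFinset, (X - C y) = h₀ + C a * h₁ := by
    conv_rhs => rw [(IsAlgClosed.splits (h₀ + C a * h₁)).eq_prod_roots_of_monic (hmonic a)]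
    rw [Finset.prod, Multiset.toFinset_val, (nodup_roots ha).dedup]
  have hmem (a : K) (ha : (h₀ + C a * h₁).Separable) :
      (h₀ + C a * h₁).roots.toFinset.card = b := by
    have h := congrArg degree (hprod a ha)
    rw [degree_add_eq_left_of_degree_lt (hlt a), hdeg₀, degree_prod] at h
    simpa using h
  refine Set.infinite_of_injOn_mapsTo (f := fun a : K => (h₀ + C a * h₁).roots.toFinset)
    ?_ ?_ hgood
  · intro a ha a' ha' h
    simp only [Set.mem_compl_iff, Set.mem_ofPred_eq, not_not] at ha ha'
    have h2 := hprod a ha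
    simp only at h
    rw [h, hprod a' ha', add_right_inj] at h2
    exact (C_injective (mul_right_cancel₀ hne h2)).symm
  · intro a ha
    simp only [Set.mem_compl_iff, Set.mem_ofPred_eq, not_not] at ha
    refine ⟨hmem a ha, ?_⟩
    obtain ⟨c', hc'⟩ := exists_eval_combination (N := N) L (h₀ + C a * h₁).roots.toFinset
      (fun j hj => by
        rw [hmem a ha] at hj
        rw [hprod a ha, mul_add, map_add, hL₀, zero_add,
          show X ^ j * (C a * h₁) = a • (X ^ j * h₁) by rw [smul_eq_C_mul]; ring, map_smul,
          hL₁ j hj, smul_zero])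
    refine ⟨c', fun k hk => ?_⟩
    have := hc' (X ^ k) (by rw [degree_X_pow]; exact_mod_cast hk)
    simpa [hLdef] using this

end Polynomial

section Conic

variable {K : Type} [Field K] {r : ℕ}

/-- The linear form with a given coefficient vector. -/
noncomputable def linForm (x : Fin (r + 1) → K) : MvPolynomial (Fin (r + 1)) K :=
  ∑ i, C (x i) * X i

lemma linForm_add (x y : Fin (r + 1) → K) : linForm (x + y) = linForm x + linForm y := by
  simp [linForm, add_mul, Finset.sum_add_distrib]

lemma linForm_smul (a : K) (x : Fin (r + 1) → K) : linForm (a • x) = C a * linForm x := by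
  simp [linForm, Finset.mul_sum, mul_assoc]

/-- The powers of the linear forms on an affine chart of a conic trace a moment curve. -/
lemma exists_conic_pow_expansion (d : ℕ) (u v w : Fin (r + 1) → K) :
    ∃ m : ℕ → MvPolynomial (Fin (r + 1)) K, ∀ x : K,
      linForm (x ^ 2 • u + x • v + w) ^ d = ∑ k ∈ Finset.range (2 * d + 1), x ^ k • m k := by
  set P : Polynomial (MvPolynomial (Fin (r + 1)) K) :=
    (Polynomial.C (linForm u) * Polynomial.X ^ 2 + Polynomial.C (linForm v) * Polynomial.X
      + Polynomial.C (linForm w)) ^ d with hP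
  have hdeg : P.natDegree < 2 * d + 1 := by
    have := Polynomial.natDegree_pow_le_of_le d (Polynomial.natDegree_quadratic_le
      (a := linForm u) (b := linForm v) (c := linForm w))
    rw [hP]
    omega
  refine ⟨P.coeff, fun x => ?_⟩
  have h := Polynomial.eval_eq_sum_range' hdeg (C x)
  calc linForm (x ^ 2 • u + x • v + w) ^ d = P.eval (C x) := by
        simp only [linForm_add, linForm_smul, hP, Polynomial.eval_pow, Polynomial.eval_add,
          Polynomial.eval_mul, Polynomial.eval_C, Polynomial.eval_X, map_pow]
        ring
    _ = _ := by
        rw [h]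
        refine Finset.sum_congr rfl fun k _ => ?_
        rw [MvPolynomial.smul_eq_C_mul, map_pow, mul_comm]

lemma conic_coeffs_eq_zero {u v w : Fin (r + 1) → K} (h : LinearIndependent K ![u, v, w])
    {a b c : K} (h0 : a • u + b • v + c • w = 0) : a = 0 ∧ b = 0 ∧ c = 0 := by
  have := Fintype.linearIndependent_iff.mp h ![a, b, c] (by simpa [Fin.sum_univ_three] using h0)
  exact ⟨this 0, this 1, this 2⟩

lemma linearIndependent_triple {u v w : Fin (r + 1) → K}
    (h : ∀ a b c : K, a • u + b • v + c • w = 0 → a = 0 ∧ b = 0 ∧ c = 0) :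
    LinearIndependent K ![u, v, w] := by
  refine Fintype.linearIndependent_iff.mpr fun g hg => ?_
  obtain ⟨h0, h1, h2⟩ := h (g 0) (g 1) (g 2) (by simpa [Fin.sum_univ_three] using hg)
  intro i
  fin_cases i <;> assumption

lemma conic_vec_ne_zero {u v w : Fin (r + 1) → K} (h : LinearIndependent K ![u, v, w]) (x : K) :
    x ^ 2 • u + x • v + w ≠ 0 := by
  intro h0
  exact one_ne_zero (conic_coeffs_eq_zero h (c := 1) (by simpa using h0)).2.2

/-- The affine parametrization of a smooth conic minus a point. -/
noncomputable def conicPoint {u v w : Fin (r + 1) → K} (h : LinearIndependent K ![u, v, w])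
    (x : K) : Projectivization K (Fin (r + 1) → K) :=
  Projectivization.mk K (x ^ 2 • u + x • v + w) (conic_vec_ne_zero h x)

lemma conicPoint_injective {u v w : Fin (r + 1) → K} (h : LinearIndependent K ![u, v, w]) :
    Function.Injective (conicPoint h) := by
  intro x y hxy
  obtain ⟨a, ha⟩ := (Projectivization.mk_eq_mk_iff' K _ _ _ _).mp hxy
  obtain ⟨-, h1, h2⟩ := conic_coeffs_eq_zero h (a := a * y ^ 2 - x ^ 2) (b := a * y - x)
    (c := a - 1) (by linear_combination (norm := module) ha)
  linear_combination y * h2 - h1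

/-- Finitely many points of a smooth conic lie in a common affine chart. -/
lemma exists_conic_chart [Infinite K] {T : Set (Projectivization K (Fin (r + 1) → K))}
    (hT : IsSmoothConic K r T) (B : Finset (Projectivization K (Fin (r + 1) → K)))
    (hB : (B : Set _) ⊆ T) :
    ∃ (u v w : Fin (r + 1) → K) (h : LinearIndependent K ![u, v, w]),
      (B : Set _) ⊆ Set.range (conicPoint h) := by
  obtain ⟨u, v, w, h, rfl⟩ := hT
  have hrev : LinearIndependent K ![w, v, u] := by
    refine linearIndependent_triple fun a b c h0 => ?_
    obtain ⟨h1, h2, h3⟩ := conic_coeffs_eq_zero h (a := c) (b := b) (c := a)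
      (by rw [← h0]; abel)
    exact ⟨h3, h2, h1⟩
  obtain ⟨q, ⟨m, rfl⟩, hq⟩ :=
    (Set.infinite_range_of_injective (conicPoint_injective hrev)).exists_notMem_finset B
  have h' : LinearIndependent K ![u + m • v + m ^ 2 • w, v + (2 * m) • w, w] := by
    refine linearIndependent_triple fun a b c h0 => ?_
    obtain ⟨h1, h2, h3⟩ := conic_coeffs_eq_zero h (a := a) (b := a * m + b)
      (c := a * m ^ 2 + b * (2 * m) + c) (by rw [← h0]; module)
    subst h1
    have hb : b = 0 := by simpa using h2
    subst hb
    exact ⟨rfl, rfl, by simpa using h3⟩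
  refine ⟨_, _, _, h', fun p hp => ?_⟩
  obtain ⟨s, t, hst, hpst⟩ := hB hp
  by_cases ht : t - m * s = 0
  · exfalso
    have ht' : t = m * s := sub_eq_zero.mp ht
    have hs : s ≠ 0 := by
      rintro rfl
      simp [ht'] at hst
    refine hq ?_
    suffices hpq : conicPoint hrev m = p by rw [hpq]; exact hp
    apply Projectivization.submodule_injective
    rw [hpst, conicPoint, Projectivization.submodule_mk,
      ← Submodule.span_singleton_smul_eq (IsUnit.mk0 (s ^ 2) (pow_ne_zero 2 hs)), ht']
    congr 2
    module
  · refine ⟨s / (t - m * s), ?_⟩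
    apply Projectivization.submodule_injective
    rw [hpst, conicPoint, Projectivization.submodule_mk,
      ← Submodule.span_singleton_smul_eq
        (IsUnit.mk0 ((t - m * s) ^ 2) (pow_ne_zero 2 ht))]
    congr 2
    match_scalars <;> field_simp <;> ring

lemma exists_powForm_mk_eq_smul (d : ℕ) (x : Fin (r + 1) → K) (hx : x ≠ 0) :
    ∃ a : K, a ≠ 0 ∧ powForm K r d (Projectivization.mk K x hx) = a • linForm x ^ d := by
  obtain ⟨a, ha⟩ := Projectivization.exists_smul_eq_mk_rep K x hx
  refine ⟨(a : K) ^ d, pow_ne_zero d a.ne_zero, ?_⟩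
  have : powForm K r d (Projectivization.mk K x hx) = linForm ((a : K) • x) ^ d := by
    rw [powForm, ← ha]
    rfl
  rw [this, linForm_smul, mul_pow, MvPolynomial.smul_eq_C_mul, map_pow]

/-- A form in the span of `b ≥ d + 1` points of an affine chart of a conic is in the span of
infinitely many `b`-tuples of points of that chart. -/
lemma infinite_conic_decompositions [IsAlgClosed K] {d : ℕ} {u v w : Fin (r + 1) → K}
    (h : LinearIndependent K ![u, v, w]) (Z : Finset K) (hZ : d + 1 ≤ Z.card)
    {g : MvPolynomial (Fin (r + 1)) K} (hg : g ∈ decompSpan K r d (conicPoint h '' Z)) :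
    {Y : Finset K | Y.card = Z.card ∧ g ∈ decompSpan K r d (conicPoint h '' Y)}.Infinite := by
  obtain ⟨m, hm⟩ := exists_conic_pow_expansion d u v w
  rw [decompSpan, Set.image_image, Submodule.mem_span_image_finset_iff_exists_fun'] at hg
  obtain ⟨c₀, rfl⟩ := hg
  choose a ha0 ha using fun x => exists_powForm_mk_eq_smul d _ (conic_vec_ne_zero h x)
  have hpow (x : K) : powForm K r d (conicPoint h x) =
      a x • ∑ k ∈ Finset.range (2 * d + 1), x ^ k • m k := by
    rw [conicPoint, ha, hm]
  refine (Polynomial.infinite_moment_decompositions (N := 2 * d + 1) Z (fun z => c₀ z * a z)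
    (by omega)).mono ?_
  rintro Y ⟨hY, c', hc'⟩
  refine ⟨hY, ?_⟩
  rw [decompSpan, Set.image_image, Submodule.mem_span_image_finset_iff_exists_fun']
  refine ⟨fun y => c' y * (a y)⁻¹, ?_⟩
  have hswap (S : Finset K) (e : K → K) :
      ∑ x ∈ S, e x • ∑ k ∈ Finset.range (2 * d + 1), x ^ k • m k =
        ∑ k ∈ Finset.range (2 * d + 1), (∑ x ∈ S, e x * x ^ k) • m k := by
    simp only [Finset.smul_sum, Finset.sum_smul, smul_smul]
    exact Finset.sum_comm
  calc ∑ y ∈ Y, (c' y * (a y)⁻¹) • powForm K r d (conicPoint h y)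
      = ∑ y ∈ Y, c' y • ∑ k ∈ Finset.range (2 * d + 1), y ^ k • m k := by
        refine Finset.sum_congr rfl fun y _ => ?_
        rw [hpow, smul_smul, inv_mul_cancel_right₀ (ha0 y)]
    _ = ∑ z ∈ Z, (c₀ z * a z) • ∑ k ∈ Finset.range (2 * d + 1), z ^ k • m k := by
        rw [hswap, hswap]
        refine Finset.sum_congr rfl fun k hk => ?_
        rw [hc' k (Finset.mem_range.mp hk)]
    _ = ∑ z ∈ Z, c₀ z • powForm K r d (conicPoint h z) := by
        refine Finset.sum_congr rfl fun z _ => ?_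
        rw [hpow, smul_smul]

end Conic

/-- if a decomposition `A ∈ S(f)` meets a smooth conic `T` in at
least `d + 1` points, then `S(f)` is infinite. -/
theorem stmt_13 {K : Type} [Field K] [IsAlgClosed K] [CharZero K]
    {r d : ℕ} (hr : 2 ≤ r) (hd : 3 ≤ d)
    {f : MvPolynomial (Fin (r + 1)) K} (hf0 : f ≠ 0) (hfh : f.IsHomogeneous d)
    {A : Finset (Projectivization K (Fin (r + 1) → K))}
    (hA : A ∈ decompSet K r d f)
    {T : Set (Projectivization K (Fin (r + 1) → K))} (hT : IsSmoothConic K r T)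
    (hcard : d + 1 ≤
      ((↑A : Set (Projectivization K (Fin (r + 1) → K))) ∩ T).ncard) :
    (decompSet K r d f).Infinite := by
  classical
  obtain ⟨hfA, hAcard⟩ := hA
  have : Infinite K := IsAlgClosed.instInfinite
  set B : Finset (Projectivization K (Fin (r + 1) → K)) :=
    A.filter (· ∈ T) with hBdef
  have hBcoe : (B : Set (Projectivization K (Fin (r + 1) → K))) = ↑A ∩ T := by
    ext p
    simp [hBdef]
  rw [← hBcoe, Set.ncard_coe_finset] at hcard
  obtain ⟨u, v, w, h, hBr⟩ := exists_conic_chart hT B (hBcoe ▸ Set.inter_subset_right)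
  obtain ⟨Z, hZ⟩ : ∃ Z : Finset K, Z.image (conicPoint h) = B := by
    obtain ⟨Z, -, hZ⟩ := Finset.subset_set_image_iff.mp
      (show (B : Set _) ⊆ conicPoint h '' Set.univ by rwa [Set.image_univ])
    exact ⟨Z, hZ⟩
  have hZcard : Z.card = B.card := by
    rw [← hZ, Finset.card_image_of_injective _ (conicPoint_injective h)]
  have hAB : A \ B ∪ B = A := Finset.sdiff_union_of_subset (Finset.filter_subset _ _)
  have hABcard : (A \ B).card + B.card = A.card :=
    Finset.card_sdiff_add_card_eq_card (Finset.filter_subset _ _)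
  have hsup (S S' : Set (Projectivization K (Fin (r + 1) → K))) :
      decompSpan K r d (S ∪ S') = decompSpan K r d S ⊔ decompSpan K r d S' := by
    rw [decompSpan, Set.image_union, Submodule.span_union, decompSpan, decompSpan]
  rw [← hAB, Finset.coe_union, hsup, Submodule.mem_sup] at hfA
  obtain ⟨g₁, hg₁, g₂, hg₂, rfl⟩ := hfA
  rw [← hZ, Finset.coe_image] at hg₂
  have hdec (Y : Finset K) (hY : Y.card = Z.card)
      (hgY : g₂ ∈ decompSpan K r d (conicPoint h '' Y)) :
      g₁ + g₂ ∈ decompSpan K r d ↑(A \ B ∪ Y.image (conicPoint h)) ∧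
        (A \ B ∪ Y.image (conicPoint h)).card = symRank K r d (g₁ + g₂) ∧
        Disjoint (A \ B) (Y.image (conicPoint h)) := by
    have hmem : g₁ + g₂ ∈ decompSpan K r d ↑(A \ B ∪ Y.image (conicPoint h)) := by
      rw [Finset.coe_union, hsup, Finset.coe_image]
      exact Submodule.add_mem_sup hg₁ hgY
    have hge : symRank K r d (g₁ + g₂) ≤ (A \ B ∪ Y.image (conicPoint h)).card :=
      Nat.sInf_le ⟨_, rfl, hmem⟩
    have hYcard : (Y.image (conicPoint h)).card = B.card := by
      rw [Finset.card_image_of_injective _ (conicPoint_injective h), hY, hZcard]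
    have hle := Finset.card_union_le (A \ B) (Y.image (conicPoint h))
    refine ⟨hmem, by omega, ?_⟩
    rw [← Finset.card_union_eq_card_add_card]
    omega
  refine Set.infinite_of_injOn_mapsTo (f := fun Y : Finset K => A \ B ∪ Y.image (conicPoint h))
    ?_ ?_ (infinite_conic_decompositions h Z (hZcard ▸ hcard) hg₂)
  · rintro Y ⟨hY, hgY⟩ Y' ⟨hY', hgY'⟩ heq
    have h1 := (hdec Y hY hgY).2.2
    have h2 := (hdec Y' hY' hgY').2.2
    refine Finset.image_injective (conicPoint_injective h) ?_
    rw [← Finset.union_sdiff_cancel_left h1, ← Finset.union_sdiff_cancel_left h2]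
    exact congrArg (· \ (A \ B)) heq
  · rintro Y ⟨hY, hgY⟩
    exact ⟨(hdec Y hY hgY).1, (hdec Y hY hgY).2.1⟩
end
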